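/- arXiv:0901.4734 — 3 statements merged into one kernel-verified Lean document; each statement's English description precedes it below -/
import Mathlib

section
/- Let H ≤ F be a subgroup. The action of H on (∂F, μ) is conservative (i.e. every measurable W ⊆ ∂F with μ(hW ∩ h′W) = 0 for all h ≠ h′ in H has μ(W) = 0) if and only if lim_{n→∞} |S_X^n| / (2m(2m−1)^{n−1}) = 0. -/
open MeasureTheory Filter Topology
open scoped ENNReal symmDiff

noncomputable section

/-- A letter of the alphabet `A ∪ A⁻¹` for the free group on `Fin m`. -/
abbrev Letter (m : ℕ) := Fin m × Bool

/-- The inverse letter. -/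
def linv {m : ℕ} (x : Letter m) : Letter m := (x.1, !x.2)

/-- A sequence of letters is reduced if no letter is followed by its inverse. -/
def IsRedSeq {m : ℕ} (ω : ℕ → Letter m) : Prop := ∀ n, ω (n + 1) ≠ linv (ω n)

/-- The boundary `∂F`: infinite reduced words. -/
abbrev Boundary (m : ℕ) := {ω : ℕ → Letter m // IsRedSeq ω}

/-- Word length of an element of the free group. -/
def wlen {m : ℕ} (g : FreeGroup (Fin m)) : ℕ := g.toWord.length

/-- The truncation `[ω]ₙ`: the group element given by the first `n` letters of `ω`. -/
def trunc {m : ℕ} (ω : Boundary m) (n : ℕ) : FreeGroup (Fin m) :=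
  FreeGroup.mk (List.ofFn fun i : Fin n => ω.1 i)

/-- Cylinder set `C_g`. -/
def cylinder {m : ℕ} (g : FreeGroup (Fin m)) : Set (Boundary m) :=
  {ω | trunc ω (wlen g) = g}

/-- The Gromov product `(g|ω)`: length of the longest common initial segment of the
reduced word of `g` and `ω`. -/
def gromov {m : ℕ} (g : FreeGroup (Fin m)) (ω : Boundary m) : ℕ :=
  sSup {k | ∀ i < k, g.toWord[i]? = some (ω.1 i)}

/-- The Busemann function `b_ω(g) = |g| - 2 (g|ω)`. -/
def busemann {m : ℕ} (g : FreeGroup (Fin m)) (ω : Boundary m) : ℤ :=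
  (wlen g : ℤ) - 2 * (gromov g ω : ℤ)

/-- The number of letters cancelled in the free reduction of the concatenation
of a finite word `w` with an infinite reduced word `ω`. -/
def cancelLen {m : ℕ} (w : List (Letter m)) (ω : ℕ → Letter m) : ℕ :=
  sSup {k | k ≤ w.length ∧ ∀ i < k, w[w.length - 1 - i]? = some (linv (ω i))}

/-- The sequence of letters of the free reduction of (reduced word of `g`) ++ `ω`. -/
def actSeq {m : ℕ} (g : FreeGroup (Fin m)) (ω : Boundary m) (n : ℕ) : Letter m :=
  if h : n < g.toWord.length - cancelLen g.toWord ω.1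
  then g.toWord[n]'(by omega)
  else ω.1 (n - (g.toWord.length - cancelLen g.toWord ω.1) + cancelLen g.toWord ω.1)

theorem linv_linv {m : ℕ} (x : Letter m) : linv (linv x) = x := by
  simp [linv]

theorem toWord_chain {m : ℕ} (g : FreeGroup (Fin m)) {j : ℕ} (hj : j + 1 < g.toWord.length) :
    g.toWord[j + 1]'hj ≠ linv (g.toWord[j]'(by omega)) := by
  intro h
  have hsplit : g.toWord = g.toWord.take j ++
      (g.toWord[j]'(by omega)) :: (g.toWord[j+1]'hj) :: g.toWord.drop (j + 2) := by
    conv_lhs => rw [← List.take_append_drop j g.toWord]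
    congr 1
    rw [List.drop_eq_getElem_cons (by omega)]
    congr 1
    rw [List.drop_eq_getElem_cons (by omega)]
  rw [h] at hsplit
  have hred : FreeGroup.reduce g.toWord = g.toWord := FreeGroup.reduce_toWord g
  exact FreeGroup.reduce.not (by rw [hred, hsplit]; rfl)

theorem cancelLen_spec {m : ℕ} (w : List (Letter m)) (ω : ℕ → Letter m) :
    cancelLen w ω ≤ w.length ∧
      ∀ i < cancelLen w ω, w[w.length - 1 - i]? = some (linv (ω i)) := by
  have : cancelLen w ω ∈
      {k | k ≤ w.length ∧ ∀ i < k, w[w.length - 1 - i]? = some (linv (ω i))} := by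
    apply Nat.sSup_mem ⟨0, by simp⟩ ⟨w.length, fun x hx => hx.1⟩
  exact this

theorem cancelLen_max {m : ℕ} (w : List (Letter m)) (ω : ℕ → Letter m)
    (hlt : cancelLen w ω < w.length) :
    w[w.length - 1 - cancelLen w ω]? ≠ some (linv (ω (cancelLen w ω))) := by
  intro hcon
  have hmem : cancelLen w ω + 1 ∈
      {k | k ≤ w.length ∧ ∀ i < k, w[w.length - 1 - i]? = some (linv (ω i))} := by
    refine ⟨hlt, fun i hi => ?_⟩
    rcases Nat.lt_succ_iff_lt_or_eq.mp hi with h | h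
    · exact (cancelLen_spec w ω).2 i h
    · subst h; exact hcon
  have := le_csSup ⟨w.length, fun x hx => hx.1⟩ hmem
  simp only [cancelLen] at this ⊢
  omega

theorem isRedSeq_actSeq {m : ℕ} (g : FreeGroup (Fin m)) (ω : Boundary m) :
    IsRedSeq (actSeq g ω) := by
  intro n
  obtain ⟨hkle, hcan⟩ := cancelLen_spec g.toWord ω.1
  by_cases h1 : n + 1 < g.toWord.length - cancelLen g.toWord ω.1
  · have h0 : n < g.toWord.length - cancelLen g.toWord ω.1 := by omega
    rw [show actSeq g ω (n + 1) = g.toWord[n + 1]'(by omega) from dif_pos h1,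
        show actSeq g ω n = g.toWord[n]'(by omega) from dif_pos h0]
    exact toWord_chain g (by omega)
  · by_cases h0 : n < g.toWord.length - cancelLen g.toWord ω.1
    · have hklt : cancelLen g.toWord ω.1 < g.toWord.length := by omega
      have hidx : n = g.toWord.length - 1 - cancelLen g.toWord ω.1 := by omega
      have e0 : actSeq g ω n = g.toWord[n]'(by omega) := dif_pos h0
      have e1 : actSeq g ω (n + 1) =
          ω.1 (n + 1 - (g.toWord.length - cancelLen g.toWord ω.1) +
            cancelLen g.toWord ω.1) := dif_neg h1
      have harg : n + 1 - (g.toWord.length - cancelLen g.toWord ω.1) +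
          cancelLen g.toWord ω.1 = cancelLen g.toWord ω.1 := by omega
      rw [harg] at e1
      rw [e0, e1]
      intro hcon
      apply cancelLen_max g.toWord ω.1 hklt
      subst hidx
      rw [List.getElem?_eq_getElem (by omega), hcon, linv_linv]
    · have e0 : actSeq g ω n =
          ω.1 (n - (g.toWord.length - cancelLen g.toWord ω.1) +
            cancelLen g.toWord ω.1) := dif_neg h0
      have e1 : actSeq g ω (n + 1) =
          ω.1 (n + 1 - (g.toWord.length - cancelLen g.toWord ω.1) +
            cancelLen g.toWord ω.1) := dif_neg (by omega)
      have harg : n + 1 - (g.toWord.length - cancelLen g.toWord ω.1) +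
          cancelLen g.toWord ω.1 =
          (n - (g.toWord.length - cancelLen g.toWord ω.1) + cancelLen g.toWord ω.1) + 1 := by
        omega
      rw [e0, e1, harg]
      exact ω.2 _

/-- The boundary action of `F` on `∂F`: `g · ω` is the free reduction of the
concatenation of the reduced word of `g` with `ω`. -/
def bact {m : ℕ} (g : FreeGroup (Fin m)) (ω : Boundary m) : Boundary m :=
  ⟨actSeq g ω, isRedSeq_actSeq g ω⟩


/-- The Schreier-graph distance from the basepoint: for a right coset `Hg`,
`normX H x = min { |hg| : h ∈ H }`. -/
def normX {m : ℕ} (H : Subgroup (FreeGroup (Fin m)))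
    (x : Quotient (QuotientGroup.rightRel H)) : ℕ :=
  sInf {n | ∃ g : FreeGroup (Fin m), Quotient.mk (QuotientGroup.rightRel H) g = x ∧ wlen g = n}

/-! ### Truncations of boundary points -/

theorem isReduced_ofFn {m : ℕ} (ω : Boundary m) (n : ℕ) :
    FreeGroup.IsReduced (List.ofFn fun i : Fin n => ω.1 i) := by
  refine List.isChain_iff_getElem.2 fun i hi h => ?_
  have := ω.2 i
  simp only [List.getElem_ofFn, linv] at *
  by_contra hne
  exact this (Prod.ext h.symm (by cases h1 : (ω.1 i).2 <;> cases h2 : (ω.1 (i + 1)).2 <;> simp_all))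

theorem toWord_trunc {m : ℕ} (ω : Boundary m) (n : ℕ) :
    (trunc ω n).toWord = List.ofFn fun i : Fin n => ω.1 i := by
  rw [trunc, FreeGroup.toWord_mk, (isReduced_ofFn ω n).reduce_eq]

theorem wlen_trunc {m : ℕ} (ω : Boundary m) (n : ℕ) : wlen (trunc ω n) = n := by
  simp [wlen, toWord_trunc]

theorem trunc_eq_trunc_iff {m : ℕ} {ω ξ : Boundary m} {n : ℕ} :
    trunc ω n = trunc ξ n ↔ ∀ i < n, ω.1 i = ξ.1 i := by
  rw [← FreeGroup.toWord_inj, toWord_trunc, toWord_trunc, List.ofFn_inj, funext_iff]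
  exact ⟨fun h i hi => h ⟨i, hi⟩, fun h i => h i i.2⟩

theorem trunc_add {m : ℕ} (ω : Boundary m) (n k : ℕ) :
    trunc ω (n + k) =
      trunc ω n * FreeGroup.mk (List.ofFn fun i : Fin k => ω.1 (n + i)) := by
  rw [trunc, trunc, FreeGroup.mul_mk, List.ofFn_add]
  rfl

theorem trunc_succ {m : ℕ} (ω : Boundary m) (n : ℕ) :
    trunc ω (n + 1) = trunc ω n * FreeGroup.mk [ω.1 n] := by
  simp [trunc_add]

theorem toWord_trunc_succ {m : ℕ} (ω : Boundary m) (n : ℕ) :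
    (trunc ω (n + 1)).toWord = (trunc ω n).toWord ++ [ω.1 n] := by
  rw [toWord_trunc, toWord_trunc, List.ofFn_succ_last]
  rfl

theorem wlen_mul_le {m : ℕ} (g h : FreeGroup (Fin m)) : wlen (g * h) ≤ wlen g + wlen h :=
  FreeGroup.norm_mul_le g h

theorem wlen_inv {m : ℕ} (g : FreeGroup (Fin m)) : wlen g⁻¹ = wlen g :=
  FreeGroup.norm_inv_eq

theorem wlen_mul_trunc_le {m : ℕ} (g : FreeGroup (Fin m)) (ω : Boundary m) {n k : ℕ}
    (hnk : n ≤ k) : wlen (g * trunc ω k) ≤ wlen (g * trunc ω n) + (k - n) := by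
  obtain ⟨j, rfl⟩ := Nat.exists_eq_add_of_le hnk
  rw [trunc_add, ← mul_assoc, Nat.add_sub_cancel_left]
  refine (wlen_mul_le _ _).trans (Nat.add_le_add_left ?_ _)
  exact FreeGroup.norm_mk_le.trans (by simp)

/-! ### The boundary action on truncations -/

theorem mk_drop_toWord {m : ℕ} (g : FreeGroup (Fin m)) (ω : Boundary m) :
    FreeGroup.mk (g.toWord.drop (g.toWord.length - cancelLen g.toWord ω.1)) =
      (trunc ω (cancelLen g.toWord ω.1))⁻¹ := by
  obtain ⟨hle, hc⟩ := cancelLen_spec g.toWord ω.1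
  rw [trunc, FreeGroup.inv_mk]
  congr 1
  refine List.ext_getElem (by simp; omega) fun i h₁ h₂ => ?_
  have h₁' : i < cancelLen g.toWord ω.1 := by simp at h₁; omega
  have := hc (cancelLen g.toWord ω.1 - 1 - i) (by omega)
  rw [List.getElem?_eq_getElem (by omega), Option.some_inj] at this
  simp only [FreeGroup.invRev, List.getElem_drop, List.getElem_reverse, List.getElem_map,
    List.getElem_ofFn, List.length_map, List.length_ofFn]
  rw [linv] at this
  rw [← this]
  congr 1
  omega

theorem trunc_bact_add {m : ℕ} (g : FreeGroup (Fin m)) (ω : Boundary m) (j : ℕ) :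
    trunc (bact g ω) (wlen g - cancelLen g.toWord ω.1 + j) =
      g * trunc ω (cancelLen g.toWord ω.1 + j) := by
  obtain ⟨hle, -⟩ := cancelLen_spec g.toWord ω.1
  have h₁ : trunc (bact g ω) (wlen g - cancelLen g.toWord ω.1) =
      FreeGroup.mk (g.toWord.take (g.toWord.length - cancelLen g.toWord ω.1)) := by
    rw [trunc]
    congr 1
    refine List.ext_getElem (by simp [wlen]) fun i h₁ h₂ => ?_
    have hi : i < g.toWord.length - cancelLen g.toWord ω.1 := by simpa [wlen] using h₁
    simp [bact, actSeq, hi]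
  have h₂ : (List.ofFn fun i : Fin j =>
      (bact g ω).1 (wlen g - cancelLen g.toWord ω.1 + i)) =
      List.ofFn fun i : Fin j => ω.1 (cancelLen g.toWord ω.1 + i) := by
    congr 1
    funext i
    simp only [bact, actSeq, wlen]
    rw [dif_neg (by omega)]
    exact congrArg ω.1 (by omega)
  have h₃ : g = FreeGroup.mk (g.toWord.take (g.toWord.length - cancelLen g.toWord ω.1)) *
      (trunc ω (cancelLen g.toWord ω.1))⁻¹ := by
    rw [← mk_drop_toWord, FreeGroup.mul_mk, List.take_append_drop, FreeGroup.mk_toWord]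
  rw [trunc_add, trunc_add, h₁, h₂, ← mul_assoc, ← eq_mul_inv_iff_mul_eq.1 h₃]

theorem cancelLen_le_wlen {m : ℕ} (g : FreeGroup (Fin m)) (ω : Boundary m) :
    cancelLen g.toWord ω.1 ≤ wlen g := (cancelLen_spec g.toWord ω.1).1

theorem trunc_bact {m : ℕ} (g : FreeGroup (Fin m)) (ω : Boundary m) {n : ℕ}
    (hn : wlen g ≤ n) :
    trunc (bact g ω) (n + wlen g - 2 * cancelLen g.toWord ω.1) = g * trunc ω n := by
  have hle := cancelLen_le_wlen g ω
  have := trunc_bact_add g ω (n - cancelLen g.toWord ω.1)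
  rwa [show cancelLen g.toWord ω.1 + (n - cancelLen g.toWord ω.1) = n by omega,
    show wlen g - cancelLen g.toWord ω.1 + (n - cancelLen g.toWord ω.1) =
      n + wlen g - 2 * cancelLen g.toWord ω.1 by omega] at this

theorem wlen_add_le_wlen_mul_trunc {m : ℕ} (g : FreeGroup (Fin m)) (ω : Boundary m) (n : ℕ) :
    n + wlen g ≤ wlen (g * trunc ω n) + 2 * cancelLen g.toWord ω.1 := by
  have hle := cancelLen_le_wlen g ω
  have h := wlen_mul_trunc_le g ω (le_max_left n (wlen g))
  rw [← trunc_bact g ω (le_max_right n (wlen g)), wlen_trunc] at h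
  omega

theorem bact_inv_bact {m : ℕ} (g : FreeGroup (Fin m)) (ω : Boundary m) :
    bact g⁻¹ (bact g ω) = ω := by
  have key : ∀ n, wlen g + wlen g ≤ n → trunc (bact g⁻¹ (bact g ω)) n = trunc ω n := by
    intro n hn
    have hle := cancelLen_le_wlen g ω
    have h := trunc_bact g⁻¹ (bact g ω) (n := n + wlen g - 2 * cancelLen g.toWord ω.1)
      (by rw [wlen_inv]; omega)
    rw [trunc_bact g ω (by omega), inv_mul_cancel_left] at h
    have hl := congrArg wlen h
    rw [wlen_trunc, wlen_trunc] at hl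
    rwa [hl] at h
  refine Subtype.ext (funext fun i => ?_)
  exact trunc_eq_trunc_iff.1 (key (wlen g + wlen g + i + 1) (by omega)) i (by omega)

theorem bact_bact_inv {m : ℕ} (g : FreeGroup (Fin m)) (ω : Boundary m) :
    bact g (bact g⁻¹ ω) = ω := by
  simpa using bact_inv_bact g⁻¹ ω

theorem image_bact_eq_preimage {m : ℕ} (g : FreeGroup (Fin m)) (s : Set (Boundary m)) :
    bact g '' s = bact g⁻¹ ⁻¹' s :=
  congrFun (Set.image_eq_preimage_of_inverse (bact_inv_bact g) (bact_bact_inv g)) s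

theorem cancelLen_congr {m : ℕ} (w : List (Letter m)) {ω ξ : ℕ → Letter m}
    (h : ∀ i < w.length, ω i = ξ i) : cancelLen w ω = cancelLen w ξ := by
  unfold cancelLen
  congr 1
  ext k
  refine and_congr_right fun hk => forall₂_congr fun i hi => ?_
  rw [h i (by omega)]

theorem preimage_bact_inv_cylinder {m : ℕ} (g : FreeGroup (Fin m)) (ω : Boundary m) {n : ℕ}
    (hn : 2 * wlen g ≤ n) :
    bact g⁻¹ ⁻¹' _root_.cylinder (trunc ω n) = _root_.cylinder (g * trunc ω n) := by
  have hle := cancelLen_le_wlen g ω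
  have hg := trunc_bact g ω (n := n) (by omega)
  have hlen := congrArg wlen hg
  rw [wlen_trunc] at hlen
  ext ξ
  simp only [Set.mem_preimage, _root_.cylinder, Set.mem_ofPred_eq, wlen_trunc]
  constructor
  · intro h
    have h' := trunc_bact g (bact g⁻¹ ξ) (n := n) (by omega)
    rw [cancelLen_congr g.toWord (ξ := ω.1) fun i hi => trunc_eq_trunc_iff.1 h i (by
      have : g.toWord.length = wlen g := rfl
      omega), bact_bact_inv, h, hlen] at h'
    exact h'
  · intro h
    rw [← hlen, ← hg] at h
    have hle' := cancelLen_le_wlen g⁻¹ (bact g ω)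
    rw [wlen_inv] at hle'
    have h₁ := trunc_bact g⁻¹ ξ (n := n + wlen g - 2 * cancelLen g.toWord ω.1)
      (by rw [wlen_inv]; omega)
    rw [h, hg, inv_mul_cancel_left] at h₁
    have hl := congrArg wlen h₁
    rw [wlen_trunc, wlen_trunc] at hl
    rwa [hl] at h₁

/-! ### Shortlex-minimal coset representatives -/

/-- The value of a word in base `2 * m + 1`, with the letters as the nonzero digits. Comparing
values amounts to comparing words in the shortlex order. -/
def wordCode {m : ℕ} (w : List (Letter m)) : ℕ :=
  w.foldl (fun a x => (2 * m + 1) * a + (2 * x.1 + (if x.2 then 1 else 0) + 1)) 0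

theorem wordCode_append_singleton {m : ℕ} (w : List (Letter m)) (x : Letter m) :
    wordCode (w ++ [x]) =
      (2 * m + 1) * wordCode w + (2 * x.1 + (if x.2 then 1 else 0) + 1) := by
  simp [wordCode]

theorem letter_digit_le {m : ℕ} (x : Letter m) :
    2 * (x.1 : ℕ) + (if x.2 then 1 else 0) + 1 ≤ 2 * m := by
  have := x.1.2
  split_ifs <;> omega

theorem wordCode_lt_pow {m : ℕ} (w : List (Letter m)) :
    wordCode w + 1 ≤ (2 * m + 1) ^ w.length := by
  induction w using List.reverseRecOn with
  | nil => simp [wordCode]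
  | append_singleton w x ih =>
    rw [wordCode_append_singleton, List.length_append, List.length_singleton, pow_succ]
    have := letter_digit_le x
    nlinarith

theorem pow_le_wordCode {m : ℕ} (w : List (Letter m)) :
    (2 * m + 1) ^ w.length ≤ 2 * m * wordCode w + 1 := by
  induction w using List.reverseRecOn with
  | nil => simp
  | append_singleton w x ih =>
    rw [wordCode_append_singleton, List.length_append, List.length_singleton, pow_succ]
    generalize 2 * (x.1 : ℕ) + (if x.2 then 1 else 0) = d
    nlinarith [Nat.zero_le (m * d)]

theorem wordCode_lt_of_length_lt {m : ℕ} {u v : List (Letter m)} (h : u.length < v.length) :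
    wordCode u < wordCode v := by
  have h₁ := wordCode_lt_pow u
  have h₂ := pow_le_wordCode v
  have h₃ : (2 * m + 1) ^ (u.length + 1) ≤ (2 * m + 1) ^ v.length :=
    Nat.pow_le_pow_right (by omega) h
  rw [pow_succ] at h₃
  obtain ⟨x, -⟩ := List.exists_mem_of_length_pos (Nat.zero_lt_of_lt h)
  have hm := x.1.pos
  by_contra! hlt
  have h₄ := Nat.mul_le_mul_left (2 * m) hlt
  have h₅ := Nat.mul_le_mul_right (2 * m + 1) h₁
  nlinarith

theorem wordCode_injective {m : ℕ} : Function.Injective (wordCode (m := m)) := by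
  intro u
  induction u using List.reverseRecOn with
  | nil =>
    intro v h
    by_contra hne
    exact absurd h (wordCode_lt_of_length_lt
      (by simpa using List.length_pos_iff.2 (Ne.symm hne))).ne
  | append_singleton u x ih =>
    intro v
    induction v using List.reverseRecOn with
    | nil => exact fun h => absurd h (wordCode_lt_of_length_lt (by simp)).ne'
    | append_singleton v y _ =>
      intro h
      rw [wordCode_append_singleton, wordCode_append_singleton] at h
      have hx := letter_digit_le x
      have hy := letter_digit_le y
      have hd := congrArg (· / (2 * m + 1)) h
      simp only [Nat.mul_add_div (show 0 < 2 * m + 1 by omega)] at hd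
      rw [Nat.div_eq_of_lt (by omega), Nat.div_eq_of_lt (by omega)] at hd
      have huv : wordCode u = wordCode v := by simpa using hd
      rw [huv, Nat.add_left_cancel_iff] at h
      rw [ih huv]
      have : x = y := by
        refine Prod.ext (Fin.ext ?_) ?_ <;> cases hx2 : x.2 <;> cases hy2 : y.2 <;>
          simp_all <;> omega
      rw [this]

theorem wordCode_le_of_sublist {m : ℕ} {u v : List (Letter m)} (h : u.Sublist v) :
    wordCode u ≤ wordCode v := by
  rcases h.length_le.lt_or_eq with hlt | heq
  · exact (wordCode_lt_of_length_lt hlt).le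
  · rw [h.eq_of_length heq]

/-- The shortlex-minimal representatives of the right cosets of `H`. -/
def shortlexReps {m : ℕ} (H : Subgroup (FreeGroup (Fin m))) : Set (FreeGroup (Fin m)) :=
  {g | ∀ h ∈ H, wordCode g.toWord ≤ wordCode (h * g).toWord}

theorem exists_mul_mem_shortlexReps {m : ℕ} (H : Subgroup (FreeGroup (Fin m)))
    (g : FreeGroup (Fin m)) : ∃ h ∈ H, h * g ∈ shortlexReps H := by
  let f : H → ℕ := fun h => wordCode ((h : FreeGroup (Fin m)) * g).toWord
  let h := Function.argmin f
  refine ⟨h, h.2, fun k hk => ?_⟩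
  rw [← mul_assoc]
  exact Function.argmin_le f ⟨k * h, H.mul_mem hk h.2⟩

theorem eq_one_of_mul_mem_shortlexReps {m : ℕ} {H : Subgroup (FreeGroup (Fin m))}
    {g h : FreeGroup (Fin m)} (hg : g ∈ shortlexReps H) (hh : h ∈ H)
    (hhg : h * g ∈ shortlexReps H) : h = 1 := by
  have h₁ := hg h hh
  have h₂ := hhg h⁻¹ (H.inv_mem hh)
  rw [inv_mul_cancel_left] at h₂
  exact mul_eq_right.1 (FreeGroup.toWord_injective (wordCode_injective (h₂.antisymm h₁)))

theorem wlen_le_of_mem_shortlexReps {m : ℕ} {H : Subgroup (FreeGroup (Fin m))}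
    {g h : FreeGroup (Fin m)} (hg : g ∈ shortlexReps H) (hh : h ∈ H) :
    wlen g ≤ wlen (h * g) := by
  by_contra! hlt
  exact (hg h hh).not_gt (wordCode_lt_of_length_lt hlt)

theorem trunc_mem_shortlexReps_of_succ {m : ℕ} {H : Subgroup (FreeGroup (Fin m))}
    {ω : Boundary m} {n : ℕ} (h : trunc ω (n + 1) ∈ shortlexReps H) :
    trunc ω n ∈ shortlexReps H := by
  intro k hk
  have h₁ := h k hk
  have h₂ : wordCode (k * trunc ω (n + 1)).toWord ≤
      wordCode ((k * trunc ω n).toWord ++ [ω.1 n]) := by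
    refine wordCode_le_of_sublist ?_
    rw [trunc_succ, ← mul_assoc]
    exact FreeGroup.toWord_mul_sublist _ (FreeGroup.mk [ω.1 n])
  rw [toWord_trunc_succ, wordCode_append_singleton] at h₁
  rw [wordCode_append_singleton] at h₂
  have := h₁.trans h₂
  exact Nat.le_of_mul_le_mul_left (Nat.le_of_add_le_add_right this) (by omega)

theorem trunc_mem_shortlexReps_of_le {m : ℕ} {H : Subgroup (FreeGroup (Fin m))}
    {ω : Boundary m} {n k : ℕ} (hnk : n ≤ k) (h : trunc ω k ∈ shortlexReps H) :
    trunc ω n ∈ shortlexReps H := by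
  induction hnk with
  | refl => exact h
  | step _ ih => exact ih (trunc_mem_shortlexReps_of_succ h)

/-- The boundary points all of whose truncations are shortlex-minimal in their right
coset of `H`. -/
def shortlexDomain {m : ℕ} (H : Subgroup (FreeGroup (Fin m))) : Set (Boundary m) :=
  ⋂ n, {ω | trunc ω n ∈ shortlexReps H}

theorem disjoint_image_shortlexDomain {m : ℕ} {H : Subgroup (FreeGroup (Fin m))}
    {h h' : FreeGroup (Fin m)} (hh : h ∈ H) (hh' : h' ∈ H) (hne : h ≠ h') :
    bact h '' shortlexDomain H ∩ bact h' '' shortlexDomain H = ∅ := by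
  refine Set.eq_empty_of_forall_notMem ?_
  rintro ξ ⟨⟨ω, hω, hωξ⟩, ω', hω', hω'ξ⟩
  have hω : ∀ n, trunc ω n ∈ shortlexReps H := Set.mem_iInter.1 hω
  have hω' : ∀ n, trunc ω' n ∈ shortlexReps H := Set.mem_iInter.1 hω'
  have e₁ := trunc_bact_add h ω (wlen h' - cancelLen h'.toWord ω'.1)
  have e₂ := trunc_bact_add h' ω' (wlen h - cancelLen h.toWord ω.1)
  rw [hωξ] at e₁
  rw [hω'ξ, add_comm, e₁, ← inv_mul_eq_iff_eq_mul, ← mul_assoc] at e₂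
  have h₁ := eq_one_of_mul_mem_shortlexReps (hω _) (H.mul_mem (H.inv_mem hh') hh)
    (e₂ ▸ hω' _)
  exact hne (inv_mul_eq_one.1 h₁).symm

theorem infinite_of_notMem_iUnion_image {m : ℕ} {H : Subgroup (FreeGroup (Fin m))}
    {ω : Boundary m} (hω : ω ∉ ⋃ h : H, bact (h : FreeGroup (Fin m)) '' shortlexDomain H) :
    {h : H | wlen (h : FreeGroup (Fin m)) ≤
      2 * cancelLen (h : FreeGroup (Fin m)).toWord ω.1}.Infinite := by
  intro hfin
  choose h hhH hh using fun n => exists_mul_mem_shortlexReps H (trunc ω n)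
  have hmem : ∀ n, (⟨h n, hhH n⟩ : H) ∈ {h : H | wlen (h : FreeGroup (Fin m)) ≤
      2 * cancelLen (h : FreeGroup (Fin m)).toWord ω.1} := by
    intro n
    have h₁ := wlen_le_of_mem_shortlexReps (hh n) (H.inv_mem (hhH n))
    rw [inv_mul_cancel_left, wlen_trunc] at h₁
    have h₂ := wlen_add_le_wlen_mul_trunc (h n) ω n
    simp only [Set.mem_ofPred_eq]
    omega
  have := hfin.to_subtype
  obtain ⟨⟨⟨k, hkH⟩, hk⟩, hinf⟩ := Finite.exists_infinite_fiber
    fun n => (⟨⟨h n, hhH n⟩, hmem n⟩ : {h : H | wlen (h : FreeGroup (Fin m)) ≤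
      2 * cancelLen (h : FreeGroup (Fin m)).toWord ω.1})
  refine hω (Set.mem_iUnion.2 ⟨⟨k⁻¹, H.inv_mem hkH⟩, bact k ω, ?_, bact_inv_bact k ω⟩)
  refine Set.mem_iInter.2 fun n => ?_
  obtain ⟨N, hN, hnN⟩ := (Set.infinite_coe_iff.1 hinf).exists_gt (n + 2 * wlen k)
  have hN : h N = k := by simpa using hN
  have hle := cancelLen_le_wlen k ω
  refine trunc_mem_shortlexReps_of_le
    (k := N + wlen k - 2 * cancelLen k.toWord ω.1) (by omega) ?_
  rw [trunc_bact k ω (by omega), ← hN]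
  exact hh N

/-! ### Measurability -/

theorem measurable_of_initial_segment {m : ℕ} {α : Type*} [MeasurableSpace α]
    {f : Boundary m → α} (N : ℕ)
    (hf : ∀ ω ξ : Boundary m, (∀ i < N, ω.1 i = ξ.1 i) → f ω = f ξ) : Measurable f := by
  intro s _
  let r : Boundary m → Fin N → Letter m := fun ω i => ω.1 i
  have hr : Measurable r :=
    measurable_pi_iff.2 fun i => (measurable_pi_apply (i : ℕ)).comp measurable_subtype_coe
  have : f ⁻¹' s = r ⁻¹' (r '' (f ⁻¹' s)) := by
    refine (Set.subset_preimage_image _ _).antisymm ?_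
    rintro ξ ⟨ω, hω, hωξ⟩
    have := hf ω ξ fun i hi => congrFun hωξ ⟨i, hi⟩
    rwa [Set.mem_preimage, ← this]
  rw [this]
  exact hr (Set.toFinite _).measurableSet

theorem measurableSet_of_initial_segment {m : ℕ} {s : Set (Boundary m)} (N : ℕ)
    (hs : ∀ ω ξ : Boundary m, (∀ i < N, ω.1 i = ξ.1 i) → (ω ∈ s ↔ ξ ∈ s)) :
    MeasurableSet s :=
  measurableSet_setOfPred.2
    (measurable_of_initial_segment N fun ω ξ h => propext (hs ω ξ h))

theorem measurableSet_trunc_mem {m : ℕ} (n : ℕ) (s : Set (FreeGroup (Fin m))) :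
    MeasurableSet {ω : Boundary m | trunc ω n ∈ s} :=
  measurableSet_of_initial_segment n fun ω ξ h => by
    rw [Set.mem_ofPred_eq, Set.mem_ofPred_eq, trunc_eq_trunc_iff.2 h]

theorem measurableSet_cylinder {m : ℕ} (g : FreeGroup (Fin m)) :
    MeasurableSet (_root_.cylinder g) :=
  measurableSet_trunc_mem (wlen g) {g}

theorem measurable_cancelLen {m : ℕ} (w : List (Letter m)) :
    Measurable fun ω : Boundary m => cancelLen w ω.1 :=
  measurable_of_initial_segment w.length fun _ _ h => cancelLen_congr w h

theorem measurable_bact {m : ℕ} (g : FreeGroup (Fin m)) : Measurable (bact g) := by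
  refine Measurable.subtype_mk (measurable_pi_iff.2 fun n => ?_)
  refine measurable_of_initial_segment (n + wlen g + 1) fun ω ξ h => ?_
  have hc := cancelLen_congr g.toWord (ω := ω.1) (ξ := ξ.1) fun i hi => h i (by
    have : g.toWord.length = wlen g := rfl
    omega)
  have hle := cancelLen_le_wlen g ξ
  simp only [actSeq, hc]
  split_ifs
  · rfl
  · exact h _ (by omega)

theorem measurableSet_shortlexDomain {m : ℕ} (H : Subgroup (FreeGroup (Fin m))) :
    MeasurableSet (shortlexDomain H) :=
  MeasurableSet.iInter fun n => measurableSet_trunc_mem n _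

theorem measurableSet_image_bact {m : ℕ} (g : FreeGroup (Fin m)) {s : Set (Boundary m)}
    (hs : MeasurableSet s) : MeasurableSet (bact g '' s) := by
  rw [image_bact_eq_preimage]
  exact measurable_bact _ hs

/-- The cylinder sets of depth at least `N`. -/
def deepCylinders (m N : ℕ) : Set (Set (Boundary m)) :=
  {s | ∃ ω : Boundary m, ∃ n, N ≤ n ∧ s = _root_.cylinder (trunc ω n)}

theorem mem_cylinder_trunc {m : ℕ} {ω ξ : Boundary m} {n : ℕ} :
    ξ ∈ _root_.cylinder (trunc ω n) ↔ trunc ξ n = trunc ω n := by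
  rw [_root_.cylinder, Set.mem_ofPred_eq, wlen_trunc]

theorem countable_deepCylinders (m N : ℕ) : (deepCylinders m N).Countable := by
  refine (Set.countable_range (_root_.cylinder (m := m))).mono ?_
  rintro _ ⟨ω, n, -, rfl⟩
  exact ⟨_, rfl⟩

theorem isPiSystem_deepCylinders (m N : ℕ) : IsPiSystem (deepCylinders m N) := by
  rintro _ ⟨ω₁, n₁, h₁, rfl⟩ _ ⟨ω₂, n₂, h₂, rfl⟩ ⟨ξ, hξ₁, hξ₂⟩
  refine ⟨ξ, max n₁ n₂, h₁.trans (le_max_left _ _), ?_⟩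
  ext ζ
  rw [mem_cylinder_trunc] at hξ₁ hξ₂
  rw [Set.mem_inter_iff, mem_cylinder_trunc, mem_cylinder_trunc, mem_cylinder_trunc, ← hξ₁, ← hξ₂]
  simp only [trunc_eq_trunc_iff, lt_max_iff]
  exact ⟨fun h i hi => hi.elim (h.1 i) (h.2 i),
    fun h => ⟨fun i hi => h i (Or.inl hi), fun i hi => h i (Or.inr hi)⟩⟩

theorem sUnion_deepCylinders (m N : ℕ) : ⋃₀ deepCylinders m N = Set.univ :=
  Set.eq_univ_of_forall fun ω =>
    Set.mem_sUnion.2 ⟨_, ⟨ω, N, le_rfl, rfl⟩, mem_cylinder_trunc.2 rfl⟩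

theorem generateFrom_deepCylinders (m N : ℕ) :
    (inferInstance : MeasurableSpace (Boundary m)) =
      MeasurableSpace.generateFrom (deepCylinders m N) := by
  refine le_antisymm ?_ (MeasurableSpace.generateFrom_le ?_)
  · have h : ∀ i, @Measurable _ _ (MeasurableSpace.generateFrom (deepCylinders m N)) _
        fun ω : Boundary m => ω.1 i := by
      intro i
      refine @measurable_to_countable' _ _ _ _ (_) _ fun x => ?_
      have : (fun ω : Boundary m => ω.1 i) ⁻¹' {x} =
          ⋃₀ {s ∈ deepCylinders m N | s ⊆ (fun ω : Boundary m => ω.1 i) ⁻¹' {x}} := by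
        refine Set.Subset.antisymm (fun ω hω => ?_) (Set.sUnion_subset fun s hs => hs.2)
        refine Set.mem_sUnion.2 ⟨_, ⟨⟨ω, N + i + 1, by omega, rfl⟩, fun ξ hξ => ?_⟩,
          mem_cylinder_trunc.2 rfl⟩
        have := trunc_eq_trunc_iff.1 (mem_cylinder_trunc.1 hξ) i (by omega)
        exact this.trans hω
      rw [this]
      exact @MeasurableSet.sUnion _ (_) _
        ((countable_deepCylinders m N).mono (Set.sep_subset _ _))
        fun s hs => MeasurableSpace.measurableSet_generateFrom hs.1
    exact measurable_iff_comap_le.1 (@measurable_pi_iff _ _ _ (_) _ _ |>.2 h)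
  · rintro _ ⟨ω, n, -, rfl⟩
    exact measurableSet_cylinder _

/-! ### The Radon–Nikodym derivative of the boundary action -/

section UniformMeasure

variable {m : ℕ} {μ : Measure (Boundary m)}

theorem map_bact_inv_eq_withDensity [IsProbabilityMeasure μ] (hm : 1 ≤ m)
    (hμ : ∀ g : FreeGroup (Fin m), g ≠ 1 →
      μ (_root_.cylinder g) = ((2 * m * (2 * m - 1) ^ (wlen g - 1) : ℕ) : ℝ≥0∞)⁻¹)
    (g : FreeGroup (Fin m)) :
    μ.map (bact g⁻¹) = μ.withDensity fun ω =>
      ((2 * m - 1 : ℕ) : ℝ≥0∞) ^ (2 * cancelLen g.toWord ω.1) *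
        (((2 * m - 1 : ℕ) : ℝ≥0∞) ^ wlen g)⁻¹ := by
  refine Measure.ext_of_generateFrom_of_cover_subset
    (generateFrom_deepCylinders m (2 * wlen g + 1)) (isPiSystem_deepCylinders _ _) subset_rfl
    (countable_deepCylinders _ _) (sUnion_deepCylinders _ _)
    (fun s _ => ?_) ?_
  · have := Measure.isProbabilityMeasure_map (μ := μ) (measurable_bact g⁻¹).aemeasurable
    exact measure_ne_top _ _
  rintro _ ⟨ω, n, hn, rfl⟩
  have hle := cancelLen_le_wlen g ω
  have hlen : wlen (g * trunc ω n) = n + wlen g - 2 * cancelLen g.toWord ω.1 := by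
    rw [← trunc_bact g ω (by omega), wlen_trunc]
  have hne : ∀ {x : FreeGroup (Fin m)}, 0 < wlen x → x ≠ 1 := by
    rintro x hx rfl
    simp [wlen] at hx
  rw [Measure.map_apply (measurable_bact _) (measurableSet_cylinder _),
    preimage_bact_inv_cylinder g ω (by omega), withDensity_apply _ (measurableSet_cylinder _),
    setLIntegral_congr_fun (g := fun _ =>
      ((2 * m - 1 : ℕ) : ℝ≥0∞) ^ (2 * cancelLen g.toWord ω.1) *
        (((2 * m - 1 : ℕ) : ℝ≥0∞) ^ wlen g)⁻¹) (measurableSet_cylinder _), setLIntegral_const,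
    hμ _ (hne (by omega)), hμ _ (hne (by rw [wlen_trunc]; omega)), wlen_trunc, hlen]
  · have hq0 : ((2 * m - 1 : ℕ) : ℝ≥0∞) ≠ 0 := by
      rw [Nat.cast_ne_zero]
      omega
    have hqt : ((2 * m - 1 : ℕ) : ℝ≥0∞) ≠ ∞ := ENNReal.natCast_ne_top _
    generalize hc : cancelLen g.toWord ω.1 = c at *
    generalize wlen g = l at *
    obtain ⟨k, rfl⟩ : ∃ k, n = k + 1 + 2 * c := ⟨n - 1 - 2 * c, by omega⟩
    rw [show k + 1 + 2 * c + l - 2 * c - 1 = k + l by omega,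
      show k + 1 + 2 * c - 1 = k + 2 * c by omega]
    simp only [Nat.cast_mul (2 * m), Nat.cast_pow]
    generalize ((2 * m - 1 : ℕ) : ℝ≥0∞) = q at *
    have hp0 : q ^ (2 * c) ≠ 0 := pow_ne_zero _ hq0
    have hpt : q ^ (2 * c) ≠ ∞ := ENNReal.pow_ne_top hqt
    have hinv : ∀ (a : ℝ≥0∞) (j : ℕ), (a * q ^ j)⁻¹ = a⁻¹ * (q ^ j)⁻¹ := fun a j =>
      ENNReal.mul_inv (Or.inr (ENNReal.pow_ne_top hqt)) (Or.inr (pow_ne_zero _ hq0))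
    rw [pow_add, pow_add, ← mul_assoc, ← mul_assoc, hinv, hinv, hinv, hinv]
    calc _ = (q ^ (2 * c) * (q ^ (2 * c))⁻¹) *
          (((2 * m : ℕ) : ℝ≥0∞)⁻¹ * (q ^ k)⁻¹ * (q ^ l)⁻¹) := by
          rw [ENNReal.mul_inv_cancel hp0 hpt, one_mul]
      _ = _ := by ring
  · intro ξ hξ
    have := cancelLen_congr g.toWord (ω := ξ.1) (ξ := ω.1) fun i hi =>
      trunc_eq_trunc_iff.1 (mem_cylinder_trunc.1 hξ) i (by
        have : g.toWord.length = wlen g := rfl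
        omega)
    simp only [this]

theorem measure_image_bact [IsProbabilityMeasure μ] (hm : 1 ≤ m)
    (hμ : ∀ g : FreeGroup (Fin m), g ≠ 1 →
      μ (_root_.cylinder g) = ((2 * m * (2 * m - 1) ^ (wlen g - 1) : ℕ) : ℝ≥0∞)⁻¹)
    (g : FreeGroup (Fin m)) {s : Set (Boundary m)} (hs : MeasurableSet s) :
    μ (bact g '' s) = ∫⁻ ω in s, ((2 * m - 1 : ℕ) : ℝ≥0∞) ^ (2 * cancelLen g.toWord ω.1) *
        (((2 * m - 1 : ℕ) : ℝ≥0∞) ^ wlen g)⁻¹ ∂μ := by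
  rw [image_bact_eq_preimage, ← Measure.map_apply (measurable_bact _) hs,
    map_bact_inv_eq_withDensity hm hμ, withDensity_apply _ hs]

theorem measure_image_bact_eq_zero [IsProbabilityMeasure μ] (hm : 1 ≤ m)
    (hμ : ∀ g : FreeGroup (Fin m), g ≠ 1 →
      μ (_root_.cylinder g) = ((2 * m * (2 * m - 1) ^ (wlen g - 1) : ℕ) : ℝ≥0∞)⁻¹)
    (g : FreeGroup (Fin m)) {s : Set (Boundary m)} (hs : MeasurableSet s) (h0 : μ s = 0) :
    μ (bact g '' s) = 0 := by
  rw [measure_image_bact hm hμ g hs, setLIntegral_measure_zero _ _ h0]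

theorem measure_le_measure_image_bact [IsProbabilityMeasure μ] (hm : 1 ≤ m)
    (hμ : ∀ g : FreeGroup (Fin m), g ≠ 1 →
      μ (_root_.cylinder g) = ((2 * m * (2 * m - 1) ^ (wlen g - 1) : ℕ) : ℝ≥0∞)⁻¹)
    (g : FreeGroup (Fin m)) {s : Set (Boundary m)} (hs : MeasurableSet s)
    (hsg : ∀ ω ∈ s, wlen g ≤ 2 * cancelLen g.toWord ω.1) :
    μ s ≤ μ (bact g '' s) := by
  rw [measure_image_bact hm hμ g hs, ← setLIntegral_one]
  refine setLIntegral_mono' hs fun ω hω => ?_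
  have hq : (1 : ℝ≥0∞) ≤ ((2 * m - 1 : ℕ) : ℝ≥0∞) := by
    rw [Nat.one_le_cast]
    omega
  rw [← div_eq_mul_inv, ENNReal.le_div_iff_mul_le
    (Or.inl (pow_ne_zero _ (zero_lt_one.trans_le hq).ne'))
    (Or.inl (ENNReal.pow_ne_top (ENNReal.natCast_ne_top _))), one_mul]
  exact pow_le_pow_right₀ hq (hsg ω hω)

/-- A wandering set is null if the domain of shortlex-minimal boundary points is null. -/
theorem measure_eq_zero_of_wandering [IsProbabilityMeasure μ] (hm : 1 ≤ m)
    (hμ : ∀ g : FreeGroup (Fin m), g ≠ 1 →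
      μ (_root_.cylinder g) = ((2 * m * (2 * m - 1) ^ (wlen g - 1) : ℕ) : ℝ≥0∞)⁻¹)
    {H : Subgroup (FreeGroup (Fin m))} (hH : μ (shortlexDomain H) = 0)
    {W : Set (Boundary m)} (hW : MeasurableSet W)
    (hWH : ∀ h h' : H, h ≠ h' →
      μ (bact (h : FreeGroup (Fin m)) '' W ∩ bact (h' : FreeGroup (Fin m)) '' W) = 0) :
    μ W = 0 := by
  let s : H → Set (Boundary m) := fun h => W ∩ {ω | wlen (h : FreeGroup (Fin m)) ≤
    2 * cancelLen (h : FreeGroup (Fin m)).toWord ω.1}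
  have hs : ∀ h, MeasurableSet (s h) := fun h =>
    hW.inter (measurableSet_le measurable_const ((measurable_cancelLen _).const_mul 2))
  have hsum : ∑' h, μ (s h) ≤ 1 := by
    calc ∑' h, μ (s h) ≤ ∑' h : H, μ (bact (h : FreeGroup (Fin m)) '' s h) :=
          ENNReal.tsum_le_tsum fun h =>
            measure_le_measure_image_bact hm hμ _ (hs h) fun ω hω => hω.2
      _ ≤ μ Set.univ := by
          refine tsum_measure_le_measure_univ
            (fun h => (measurableSet_image_bact _ (hs h)).nullMeasurableSet) fun h h' hne => ?_
          exact measure_mono_null (Set.inter_subset_inter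
            (Set.image_mono Set.inter_subset_left) (Set.image_mono Set.inter_subset_left))
            (hWH h h' hne)
      _ = 1 := measure_univ
  have hlim := measure_limsup_cofinite_eq_zero (hsum.trans_lt ENNReal.one_lt_top).ne
  have hU : μ (⋃ h : H, bact (h : FreeGroup (Fin m)) '' shortlexDomain H) = 0 :=
    measure_iUnion_null fun h =>
      measure_image_bact_eq_zero hm hμ _ (measurableSet_shortlexDomain H) hH
  refine measure_mono_null (fun ω hω => ?_) (measure_union_null hlim hU)
  by_cases hmem : ω ∈ ⋃ h : H, bact (h : FreeGroup (Fin m)) '' shortlexDomain H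
  · exact Or.inr hmem
  · refine Or.inl (mem_limsup_iff_frequently_mem.2 (frequently_cofinite_iff_infinite.2 ?_))
    exact (infinite_of_notMem_iUnion_image hmem).mono fun h hh => ⟨hω, hh⟩

/-! ### Spheres in the Schreier graph -/

theorem mk_eq_mk_iff_rightRel {H : Subgroup (FreeGroup (Fin m))} {g g' : FreeGroup (Fin m)} :
    Quotient.mk (QuotientGroup.rightRel H) g = Quotient.mk (QuotientGroup.rightRel H) g' ↔
      ∃ h ∈ H, h * g = g' := by
  rw [Quotient.eq, QuotientGroup.rightRel_apply]
  constructor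
  · exact fun h => ⟨_, h, inv_mul_cancel_right _ _⟩
  · rintro ⟨h, hh, rfl⟩
    rwa [mul_inv_cancel_right]

theorem normX_mk_of_mem_shortlexReps {H : Subgroup (FreeGroup (Fin m))} {g : FreeGroup (Fin m)}
    (hg : g ∈ shortlexReps H) :
    normX H (Quotient.mk (QuotientGroup.rightRel H) g) = wlen g := by
  refine le_antisymm (Nat.sInf_le ⟨g, rfl, rfl⟩) (le_csInf ⟨_, g, rfl, rfl⟩ ?_)
  rintro _ ⟨g', hg', rfl⟩
  obtain ⟨h, hh, rfl⟩ := mk_eq_mk_iff_rightRel.1 hg'.symm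
  exact wlen_le_of_mem_shortlexReps hg hh

theorem card_sphere_eq (H : Subgroup (FreeGroup (Fin m))) (n : ℕ) :
    Nat.card {x : Quotient (QuotientGroup.rightRel H) // normX H x = n} =
      Nat.card {g : FreeGroup (Fin m) // g ∈ shortlexReps H ∧ wlen g = n} := by
  refine (Nat.card_congr (Equiv.ofBijective (fun g => ⟨Quotient.mk _ g.1,
    (normX_mk_of_mem_shortlexReps g.2.1).trans g.2.2⟩) ⟨?_, ?_⟩)).symm
  · rintro ⟨g, hg, _⟩ ⟨g', hg', _⟩ heq
    obtain ⟨h, hh, rfl⟩ := mk_eq_mk_iff_rightRel.1 (Subtype.ext_iff.1 heq)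
    simp [eq_one_of_mul_mem_shortlexReps hg hh hg']
  · rintro ⟨x, hx⟩
    induction x using Quotient.inductionOn with
    | h g =>
      obtain ⟨h, hh, hhg⟩ := exists_mul_mem_shortlexReps H g
      have heq : Quotient.mk (QuotientGroup.rightRel H) (h * g) = Quotient.mk _ g :=
        (mk_eq_mk_iff_rightRel.2 ⟨h, hh, rfl⟩).symm
      refine ⟨⟨h * g, hhg, ?_⟩, Subtype.ext heq⟩
      rw [← normX_mk_of_mem_shortlexReps hhg, heq, hx]

theorem finite_wlen_eq (n : ℕ) : {g : FreeGroup (Fin m) | wlen g = n}.Finite :=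
  (List.finite_length_eq (Letter m) n).preimage FreeGroup.toWord_injective.injOn

theorem measure_trunc_mem_shortlexReps
    (hμ : ∀ g : FreeGroup (Fin m), g ≠ 1 →
      μ (_root_.cylinder g) = ((2 * m * (2 * m - 1) ^ (wlen g - 1) : ℕ) : ℝ≥0∞)⁻¹)
    (H : Subgroup (FreeGroup (Fin m))) {n : ℕ} (hn : 1 ≤ n) :
    μ {ω | trunc ω n ∈ shortlexReps H} =
      Nat.card {x : Quotient (QuotientGroup.rightRel H) // normX H x = n} /
        ((2 * m * (2 * m - 1) ^ (n - 1) : ℕ) : ℝ≥0∞) := by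
  have hfin : {g : FreeGroup (Fin m) | g ∈ shortlexReps H ∧ wlen g = n}.Finite :=
    (finite_wlen_eq n).subset fun g hg => hg.2
  have hset : {ω : Boundary m | trunc ω n ∈ shortlexReps H} =
      ⋃ g ∈ hfin.toFinset, _root_.cylinder g := by
    ext ω
    simp only [Set.mem_iUnion, Set.Finite.mem_toFinset, Set.mem_ofPred_eq, _root_.cylinder,
      exists_prop]
    constructor
    · exact fun h => ⟨_, ⟨h, wlen_trunc ω n⟩, by rw [wlen_trunc]⟩
    · rintro ⟨g, ⟨hg, rfl⟩, hω⟩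
      rwa [hω]
  rw [hset, measure_biUnion_finset _ fun g _ => measurableSet_cylinder g,
    Finset.sum_congr rfl (g := fun _ => ((2 * m * (2 * m - 1) ^ (n - 1) : ℕ) : ℝ≥0∞)⁻¹),
    Finset.sum_const, nsmul_eq_mul, div_eq_mul_inv, card_sphere_eq]
  · congr 2
    exact (Nat.card_eq_card_finite_toFinset hfin).symm
  · intro g hg
    have hg' := (hfin.mem_toFinset.1 hg).2
    rw [hμ g, hg']
    rintro rfl
    simp [wlen] at hg'
    omega
  · intro g hg g' hg' hne
    refine Set.disjoint_left.2 fun ω (hω : trunc ω _ = g) (hω' : trunc ω _ = g') => hne ?_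
    rw [(hfin.mem_toFinset.1 hg).2] at hω
    rw [(hfin.mem_toFinset.1 hg').2] at hω'
    exact hω.symm.trans hω'

theorem tendsto_sphere_ratio [IsProbabilityMeasure μ]
    (hμ : ∀ g : FreeGroup (Fin m), g ≠ 1 →
      μ (_root_.cylinder g) = ((2 * m * (2 * m - 1) ^ (wlen g - 1) : ℕ) : ℝ≥0∞)⁻¹)
    (H : Subgroup (FreeGroup (Fin m))) :
    Tendsto (fun n : ℕ =>
        (Nat.card {x : Quotient (QuotientGroup.rightRel H) // normX H x = n} : ℝ) /
          ((2 * m * (2 * m - 1) ^ (n - 1) : ℕ) : ℝ)) atTop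
      (𝓝 (μ (shortlexDomain H)).toReal) := by
  have h := tendsto_measure_iInter_atTop (μ := μ)
    (fun n => (measurableSet_trunc_mem n (shortlexReps H)).nullMeasurableSet)
    (fun _ _ hnk _ hω => trunc_mem_shortlexReps_of_le hnk hω) ⟨0, measure_ne_top _ _⟩
  refine ((ENNReal.tendsto_toReal (measure_ne_top μ _)).comp h).congr' ?_
  filter_upwards [eventually_ge_atTop 1] with n hn
  rw [Function.comp_apply, Function.comp_apply, measure_trunc_mem_shortlexReps hμ H hn,
    ENNReal.toReal_div, ENNReal.toReal_natCast, ENNReal.toReal_natCast]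

end UniformMeasure

/-- **Conservativity criterion.** The boundary action of `H` on `(∂F, μ)` is conservative
iff `|S_X^n| / (2m(2m-1)^{n-1}) → 0`. -/
theorem conservative_iff_sphere_ratio_tendsto_zero (m : ℕ) (hm : 2 ≤ m)
    (μ : Measure (Boundary m)) [IsProbabilityMeasure μ]
    (hμ : ∀ g : FreeGroup (Fin m), g ≠ 1 →
      μ (cylinder g) = ((2 * m * (2 * m - 1) ^ (wlen g - 1) : ℕ) : ℝ≥0∞)⁻¹)
    (H : Subgroup (FreeGroup (Fin m))) :
    (∀ W : Set (Boundary m), MeasurableSet W →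
        (∀ h h' : H, h ≠ h' →
          μ (bact (h : FreeGroup (Fin m)) '' W ∩ bact (h' : FreeGroup (Fin m)) '' W) = 0) →
        μ W = 0) ↔
      Tendsto (fun n : ℕ =>
        (Nat.card {x : Quotient (QuotientGroup.rightRel H) // normX H x = n} : ℝ) /
          ((2 * m * (2 * m - 1) ^ (n - 1) : ℕ) : ℝ)) atTop (𝓝 0) := by
  have hlim := tendsto_sphere_ratio hμ H
  constructor
  · intro hcons
    rwa [hcons _ (measurableSet_shortlexDomain H) fun h h' hne => by
      rw [disjoint_image_shortlexDomain h.2 h'.2 fun heq => hne (Subtype.ext heq),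
        measure_empty], ENNReal.toReal_zero] at hlim
  · intro h0 W hW hWH
    have hH := (ENNReal.toReal_eq_zero_iff _).1 (tendsto_nhds_unique hlim h0)
    exact measure_eq_zero_of_wandering (by omega) hμ
      (hH.resolve_right (measure_ne_top _ _)) hW hWH
end
end

section
/- Let H ≤ F be a subgroup. If lim_{n→∞} |S_X^n| / (2m(2m−1)^{n−1}) = 0 (in particular, if limsup_{n→∞} |B_X^n|^{1/n} < 2m−1), then the growth rate of H in F satisfies limsup_{n→∞} |{ h ∈ H : |h| ≤ n }|^{1/n} ≥ √(2m−1). -/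
open MeasureTheory Filter Topology
open scoped ENNReal symmDiff

noncomputable section

/-- The words `w` of length `n` such that `x :: w` is reduced. -/
def redTails {m : ℕ} : ℕ → Letter m → Finset (List (Letter m))
  | 0, _ => {[]}
  | n + 1, x => (Finset.univ.erase (linv x)).biUnion fun y => (redTails n y).image (y :: ·)

theorem ne_linv_iff {m : ℕ} {x y : Letter m} : y ≠ linv x ↔ (x.1 = y.1 → x.2 = y.2) := by
  obtain ⟨a, b⟩ := x
  obtain ⟨c, d⟩ := y
  cases b <;> cases d <;> simp [linv, eq_comm]

theorem mem_redTails {m : ℕ} {n : ℕ} {x : Letter m} {w : List (Letter m)} :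
    w ∈ redTails n x ↔ w.length = n ∧ FreeGroup.IsReduced (x :: w) := by
  induction n generalizing x w with
  | zero => cases w <;> simp [redTails]
  | succ n ih =>
    cases w with
    | nil => simp [redTails]
    | cons y w =>
      simp only [redTails, Finset.mem_biUnion, Finset.mem_erase, Finset.mem_univ, and_true,
        Finset.mem_image, List.cons.injEq, List.length_cons, Nat.add_right_cancel_iff,
        FreeGroup.isReduced_cons_cons, ← ne_linv_iff]
      constructor
      · rintro ⟨z, hz, v, hv, rfl, rfl⟩
        exact ⟨(ih.1 hv).1, hz, (ih.1 hv).2⟩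
      · rintro ⟨h1, h2, h3⟩
        exact ⟨y, h2, w, ih.2 ⟨h1, h3⟩, rfl, rfl⟩

theorem card_redTails {m : ℕ} (n : ℕ) (x : Letter m) :
    (redTails n x).card = (2 * m - 1) ^ n := by
  induction n generalizing x with
  | zero => simp [redTails]
  | succ n ih =>
    rw [redTails, Finset.card_biUnion]
    · simp only [Finset.card_image_of_injective _ List.cons_injective, ih, Finset.sum_const,
        Finset.card_erase_of_mem (Finset.mem_univ _), Finset.card_univ, Fintype.card_prod,
        Fintype.card_fin, Fintype.card_bool, smul_eq_mul]
      rw [pow_succ', mul_comm m]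
    · intro y _ z _ hyz
      rw [Function.onFun, Finset.disjoint_left]
      simp only [Finset.mem_image]
      rintro _ ⟨v, _, rfl⟩ ⟨w, _, h⟩
      exact hyz (List.cons.inj h).1.symm

theorem card_biUnion_redTails_le {m : ℕ} (n : ℕ) :
    (Finset.univ.biUnion (redTails (m := m) n)).card ≤ 2 * m * (2 * m - 1) ^ n := by
  refine Finset.card_biUnion_le.trans ?_
  simp [card_redTails, mul_comm m]

theorem mem_biUnion_redTails {m : ℕ} [NeZero m] {w : List (Letter m)}
    (hw : FreeGroup.IsReduced w) : w ∈ Finset.univ.biUnion (redTails (m := m) w.length) := by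
  simp only [Finset.mem_biUnion, Finset.mem_univ, true_and, mem_redTails]
  cases w with
  | nil => exact ⟨(0, true), by simp⟩
  | cons y w => exact ⟨y, by simp [FreeGroup.isReduced_cons_cons, hw]⟩

/-- Two words of equal length split off their longest common suffix. -/
theorem exists_common_suffix {α : Type*} (v w : List α) (h : v.length = w.length) :
    ∃ a b c : List α, v = a ++ c ∧ w = b ++ c ∧ a.length = b.length ∧
      ∀ x ∈ a.getLast?, ∀ y ∈ b.getLast?, x ≠ y := by
  induction v using List.reverseRecOn generalizing w with
  | nil => exact ⟨[], w, [], by simp_all⟩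
  | append_singleton v x ih =>
    cases w using List.reverseRecOn with
    | nil => simp at h
    | append_singleton w y =>
      by_cases hxy : x = y
      · subst hxy
        obtain ⟨a, b, c, rfl, rfl, h1, h2⟩ := ih w (by simpa using h)
        exact ⟨a, b, c ++ [x], by simp, by simp, h1, h2⟩
      · exact ⟨v ++ [x], w ++ [y], [], by simp, by simp, h, by simpa using hxy⟩

theorem isReduced_invRev {α : Type*} {w : List (α × Bool)} (hw : FreeGroup.IsReduced w) :
    FreeGroup.IsReduced (FreeGroup.invRev w) := by
  rw [FreeGroup.isReduced_iff_not_step] at hw ⊢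
  intro v hv
  have := hv.invRev
  rw [FreeGroup.invRev_invRev] at this
  exact hw _ this

theorem isReduced_append_invRev {α : Type*} {a b : List (α × Bool)}
    (ha : FreeGroup.IsReduced a) (hb : FreeGroup.IsReduced b)
    (h : ∀ x ∈ a.getLast?, ∀ y ∈ b.getLast?, x ≠ y) :
    FreeGroup.IsReduced (b ++ FreeGroup.invRev a) := by
  refine List.isChain_append.2 ⟨hb, isReduced_invRev ha, ?_⟩
  intro y hy z hz
  simp only [FreeGroup.invRev, List.head?_reverse, List.getLast?_map, Option.mem_def,
    Option.map_eq_some_iff] at hz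
  obtain ⟨x, hx, rfl⟩ := hz
  have hxy := h x hx y hy
  obtain ⟨i, s⟩ := x
  obtain ⟨j, t⟩ := y
  rintro rfl
  cases s <;> cases t <;> simp_all

theorem finite_wlen_le (m n : ℕ) : {g : FreeGroup (Fin m) | wlen g ≤ n}.Finite := by
  refine ((List.finite_length_le (Letter m) n).preimage
    FreeGroup.toWord_injective.injOn).subset fun g hg => hg

theorem card_wlen_le_le (m n : ℕ) :
    Nat.card {g : FreeGroup (Fin m) // wlen g ≤ n} ≤ (2 * m + 1) ^ n := by
  have hinj : Function.Injective (fun (g : {g : FreeGroup (Fin m) // wlen g ≤ n}) (i : Fin n) =>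
      g.1.toWord[(i : ℕ)]?) := by
    rintro ⟨g, hg⟩ ⟨g', hg'⟩ h
    refine Subtype.ext (FreeGroup.toWord_injective (List.ext_getElem? fun i => ?_))
    by_cases hi : i < n
    · exact congrFun h ⟨i, hi⟩
    · simp only [wlen] at hg hg'
      rw [List.getElem?_eq_none (hg.trans (not_lt.1 hi)),
        List.getElem?_eq_none (hg'.trans (not_lt.1 hi))]
  refine (Nat.card_le_card_of_injective _ hinj).trans ?_
  simp [mul_comm m]

theorem finite_normX_eq {m : ℕ} (H : Subgroup (FreeGroup (Fin m))) (n : ℕ) :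
    {x : Quotient (QuotientGroup.rightRel H) | normX H x = n}.Finite := by
  refine ((finite_wlen_le m n).image (Quotient.mk (QuotientGroup.rightRel H))).subset ?_
  rintro x rfl
  obtain ⟨g, hg, hl⟩ := Nat.sInf_mem (s := {n | ∃ g : FreeGroup (Fin m),
    Quotient.mk (QuotientGroup.rightRel H) g = x ∧ wlen g = n})
    (by obtain ⟨g, rfl⟩ := Quotient.exists_rep x; exact ⟨_, g, rfl, rfl⟩)
  exact ⟨g, hl.le, hg⟩

theorem normX_mk_le {m : ℕ} (H : Subgroup (FreeGroup (Fin m))) (g : FreeGroup (Fin m)) :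
    normX H (Quotient.mk (QuotientGroup.rightRel H) g) ≤ wlen g :=
  Nat.sInf_le ⟨g, rfl, rfl⟩

/-- A finite set of cosets in the ball of radius `n` is at most as large as the ball. -/
theorem card_le_sum_card_sphere {m : ℕ} (H : Subgroup (FreeGroup (Fin m))) (n : ℕ)
    (T : Finset (Quotient (QuotientGroup.rightRel H))) (hT : ∀ x ∈ T, normX H x ≤ n) :
    T.card ≤ ∑ k ∈ Finset.range (n + 1),
      Nat.card {x : Quotient (QuotientGroup.rightRel H) // normX H x = k} := by
  rw [Finset.card_eq_sum_card_fiberwise (f := normX H) (t := Finset.range (n + 1))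
    (fun x hx => by simpa [Nat.lt_succ_iff] using hT x hx)]
  refine Finset.sum_le_sum fun k _ => ?_
  rw [← Set.ncard_coe_finset]
  exact Set.ncard_le_ncard (fun x hx => (Finset.mem_filter.1 (Finset.mem_coe.1 hx)).2)
    (finite_normX_eq H k)

/-- Cauchy-Schwarz: the number of pairs in `A` with equal image controls the image from below. -/
theorem card_sq_le_card_image_mul {α β : Type*} [DecidableEq β] (A : Finset α) (f : α → β) :
    A.card ^ 2 ≤ (A.image f).card * ((A ×ˢ A).filter fun p => f p.1 = f p.2).card := by
  have hP : ((A ×ˢ A).filter fun p => f p.1 = f p.2).card =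
      ∑ b ∈ A.image f, (A.filter fun a => f a = b).card ^ 2 := by
    rw [Finset.card_eq_sum_card_fiberwise (f := fun p => f p.1) (t := A.image f)]
    · refine Finset.sum_congr rfl fun b _ => ?_
      rw [sq, ← Finset.card_product]
      congr 1
      ext ⟨a, a'⟩
      simp only [Finset.mem_filter, Finset.mem_product]
      grind
    · intro p hp
      simp only [Finset.coe_filter, Finset.mem_product, Set.mem_ofPred_eq] at hp
      exact Finset.mem_coe.2 (Finset.mem_image_of_mem _ hp.1.1)
  rw [hP, Finset.card_eq_sum_card_image f A]
  exact sq_sum_le_card_mul_sum_sq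

open Classical in
/-- Pairs of reduced words of length `n` in a common coset of `H` are bounded in terms of the
elements of `H` of length at most `2 * k` and the reduced words of length `n - k`. -/
theorem card_pairs_le {m : ℕ} [NeZero m] (H : Subgroup (FreeGroup (Fin m))) (n : ℕ)
    (A : Finset (List (Letter m))) (hA : ∀ w ∈ A, w.length = n ∧ FreeGroup.IsReduced w) :
    ((A ×ˢ A).filter fun p => Quotient.mk (QuotientGroup.rightRel H) (FreeGroup.mk p.1) =
      Quotient.mk (QuotientGroup.rightRel H) (FreeGroup.mk p.2)).card ≤
    ∑ k ∈ Finset.range (n + 1),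
      Nat.card {g : FreeGroup (Fin m) // g ∈ H ∧ wlen g ≤ 2 * k} *
        (2 * m * (2 * m - 1) ^ (n - k)) := by
  have hfin : ∀ j, {g : FreeGroup (Fin m) | g ∈ H ∧ wlen g ≤ j}.Finite := fun j =>
    (finite_wlen_le m j).subset fun g hg => hg.2
  have hsub : ((A ×ˢ A).filter fun p => Quotient.mk (QuotientGroup.rightRel H) (FreeGroup.mk p.1) =
      Quotient.mk (QuotientGroup.rightRel H) (FreeGroup.mk p.2)) ⊆
      (Finset.range (n + 1)).biUnion fun k =>
        ((hfin (2 * k)).toFinset ×ˢ Finset.univ.biUnion (redTails (m := m) (n - k))).image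
          fun p => (FreeGroup.invRev (p.1.toWord.drop k) ++ p.2, p.1.toWord.take k ++ p.2) := by
    rintro ⟨v, w⟩ hvw
    simp only [Finset.mem_filter, Finset.mem_product] at hvw
    obtain ⟨⟨hv, hw⟩, heq⟩ := hvw
    obtain ⟨hvn, hvr⟩ := hA v hv
    obtain ⟨hwn, hwr⟩ := hA w hw
    obtain ⟨a, b, c, rfl, rfl, hab, hlast⟩ := exists_common_suffix v w (hvn.trans hwn.symm)
    have hmem : FreeGroup.mk (b ++ c) * (FreeGroup.mk (a ++ c))⁻¹ ∈ H :=
      QuotientGroup.rightRel_apply.1 (Quotient.exact heq)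
    have hg : FreeGroup.mk (b ++ c) * (FreeGroup.mk (a ++ c))⁻¹ =
        FreeGroup.mk (b ++ FreeGroup.invRev a) := by
      rw [← FreeGroup.mul_mk, ← FreeGroup.mul_mk, ← FreeGroup.mul_mk, ← FreeGroup.inv_mk]
      group
    have hred : (FreeGroup.mk (b ++ FreeGroup.invRev a)).toWord = b ++ FreeGroup.invRev a := by
      rw [FreeGroup.toWord_mk]
      exact (isReduced_append_invRev (List.isChain_append.1 hvr).1
        (List.isChain_append.1 hwr).1 hlast).reduce_eq
    rw [hg] at hmem
    have hcn : n - b.length = c.length := by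
      rw [← hwn]; simp
    refine Finset.mem_biUnion.2 ⟨b.length, ?_, Finset.mem_image.2
      ⟨(FreeGroup.mk (b ++ FreeGroup.invRev a), c), Finset.mem_product.2 ⟨?_, ?_⟩, ?_⟩⟩
    · rw [Finset.mem_range, ← hwn]
      simp
    · simp only [Set.Finite.mem_toFinset, Set.mem_ofPred_eq, wlen, hred]
      refine ⟨hmem, ?_⟩
      simp [hab]
      omega
    · rw [hcn]
      exact mem_biUnion_redTails (List.isChain_append.1 hvr).2.1
    · simp only [hred]
      simp [FreeGroup.invRev_invRev]
  refine (Finset.card_le_card hsub).trans (Finset.card_biUnion_le.trans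
    (Finset.sum_le_sum fun k _ => Finset.card_image_le.trans ?_))
  rw [Finset.card_product]
  refine Nat.mul_le_mul (le_of_eq ?_) (card_biUnion_redTails_le _)
  exact (Set.ncard_eq_toFinset_card _ (hfin (2 * k))).symm

theorem pow_sq_le_sum_mul_sum {m : ℕ} [NeZero m] (H : Subgroup (FreeGroup (Fin m))) (n : ℕ) :
    ((2 * m - 1) ^ n) ^ 2 ≤
      (∑ k ∈ Finset.range (n + 1),
        Nat.card {x : Quotient (QuotientGroup.rightRel H) // normX H x = k}) *
      ∑ k ∈ Finset.range (n + 1),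
        Nat.card {g : FreeGroup (Fin m) // g ∈ H ∧ wlen g ≤ 2 * k} *
          (2 * m * (2 * m - 1) ^ (n - k)) := by
  classical
  have hA : ∀ w ∈ redTails n ((0, true) : Letter m), w.length = n ∧ FreeGroup.IsReduced w :=
    fun w hw => ⟨(mem_redTails.1 hw).1,
      List.IsChain.tail (mem_redTails.1 hw).2⟩
  rw [← card_redTails n ((0, true) : Letter m)]
  refine (card_sq_le_card_image_mul _ fun w =>
    Quotient.mk (QuotientGroup.rightRel H) (FreeGroup.mk w)).trans
    (Nat.mul_le_mul (card_le_sum_card_sphere H n _ ?_) (card_pairs_le H n _ hA))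
  intro x hx
  obtain ⟨w, hw, rfl⟩ := Finset.mem_image.1 hx
  refine (normX_mk_le H _).trans ?_
  rw [wlen, FreeGroup.toWord_mk, (hA w hw).2.reduce_eq, (hA w hw).1]

/-- If `h n ^ (1 / n)` is eventually below `r`, then `h` is at most a multiple of `r ^ n`. -/
theorem exists_le_mul_pow {h : ℕ → ℝ} (h0 : ∀ n, 0 ≤ h n) {r : ℝ} (hr : 0 < r)
    (hev : ∀ᶠ n in atTop, h n ^ ((n : ℝ)⁻¹) < r) : ∃ C, 0 < C ∧ ∀ n, h n ≤ C * r ^ n := by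
  obtain ⟨N, hN⟩ := eventually_atTop.1 hev
  have hs : ∀ k ∈ Finset.range (N + 1), 0 ≤ h k / r ^ k := fun k _ => by
    have := h0 k
    positivity
  refine ⟨1 + ∑ k ∈ Finset.range (N + 1), h k / r ^ k,
    by linarith [Finset.sum_nonneg hs], fun n => ?_⟩
  rw [← div_le_iff₀ (by positivity)]
  by_cases hn : n ≤ N
  · have := Finset.single_le_sum hs (Finset.mem_range.2 (Nat.lt_succ_of_le hn))
    linarith
  · have hlt := hN n (by omega)
    have hle : h n ≤ r ^ n := by
      rw [← Real.rpow_inv_natCast_pow (h0 n) (show n ≠ 0 by omega)]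
      exact pow_le_pow_left₀ (Real.rpow_nonneg (h0 n) _) hlt.le n
    have : h n / r ^ n ≤ 1 := (div_le_one (by positivity)).2 hle
    linarith [Finset.sum_nonneg hs]

theorem sum_pow_mul_pow_le {x q : ℝ} (hx : 0 ≤ x) (hxq : x < q) (n : ℕ) :
    ∑ k ∈ Finset.range (n + 1), x ^ k * q ^ (n - k) ≤ q ^ n * (1 - x / q)⁻¹ := by
  have hq : 0 < q := hx.trans_lt hxq
  have hterm : ∀ k ∈ Finset.range (n + 1), x ^ k * q ^ (n - k) = q ^ n * (x / q) ^ k := by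
    intro k hk
    rw [div_pow, ← Nat.sub_add_cancel (Nat.lt_succ_iff.1 (Finset.mem_range.1 hk)), pow_add]
    simp
    field_simp
  rw [Finset.sum_congr rfl hterm, ← Finset.mul_sum]
  have h1 : x / q < 1 := (div_lt_one hq).2 hxq
  have hs := summable_geometric_of_lt_one (div_nonneg hx hq.le) h1
  rw [← tsum_geometric_of_lt_one (div_nonneg hx hq.le) h1]
  gcongr
  exact hs.sum_le_tsum _ fun k _ => by positivity

/-- Partial sums of a sequence that is `o(q ^ n)` do not dominate a multiple of `q ^ n`. -/
theorem not_forall_pow_le_mul_sum {q : ℝ} (hq : 2 ≤ q) {s : ℕ → ℝ}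
    (hs : ∀ ε > 0, ∀ᶠ n in atTop, s n ≤ ε * q ^ n) {C : ℝ} (hC : 0 < C) :
    ¬ ∀ n, q ^ n ≤ C * ∑ k ∈ Finset.range (n + 1), s k := by
  intro hall
  have hgeom : ∀ n, ∑ k ∈ Finset.range (n + 1), q ^ k ≤ 2 * q ^ n := by
    intro n
    induction n with
    | zero => simp
    | succ n ih =>
      rw [Finset.sum_range_succ, pow_succ]
      nlinarith [pow_pos (show 0 < q by linarith) n]
  obtain ⟨N, hN⟩ := eventually_atTop.1 (hs (1 / (4 * C)) (by positivity))
  set D := ∑ k ∈ Finset.range N, |s k| with hD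
  have hbd : ∀ n, ∑ k ∈ Finset.range (n + 1), s k ≤ D + 1 / (4 * C) * (2 * q ^ n) := by
    intro n
    have hpt : ∀ k ∈ Finset.range (n + 1),
        s k ≤ (if k < N then |s k| else 0) + 1 / (4 * C) * q ^ k := by
      intro k _
      have hp : 0 ≤ 1 / (4 * C) * q ^ k := by positivity
      split_ifs with hk
      · linarith [le_abs_self (s k)]
      · linarith [hN k (by omega)]
    refine (Finset.sum_le_sum hpt).trans ?_
    rw [Finset.sum_add_distrib, ← Finset.mul_sum, ← Finset.sum_filter]
    refine add_le_add (Finset.sum_le_sum_of_subset_of_nonneg ?_ fun _ _ _ => abs_nonneg _)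
      (mul_le_mul_of_nonneg_left (hgeom n) (by positivity))
    intro k hk
    simpa using (Finset.mem_filter.1 hk).2
  obtain ⟨n, hn⟩ := ((tendsto_pow_atTop_atTop_of_one_lt
    (show 1 < q by linarith)).eventually_gt_atTop (2 * (C * D))).exists
  have h1 := (hall n).trans (mul_le_mul_of_nonneg_left (hbd n) hC.le)
  have h2 : C * (D + 1 / (4 * C) * (2 * q ^ n)) = C * D + q ^ n / 2 := by
    field_simp
    ring
  linarith

theorem isBoundedUnder_cogrowth {m : ℕ} (H : Subgroup (FreeGroup (Fin m))) :
    IsBoundedUnder (· ≤ ·) atTop (fun n : ℕ =>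
      (Nat.card {g : FreeGroup (Fin m) // g ∈ H ∧ wlen g ≤ n} : ℝ) ^ ((n : ℝ)⁻¹)) := by
  refine isBoundedUnder_of_eventually_le (a := ((2 * m + 1 : ℕ) : ℝ)) ?_
  filter_upwards [eventually_ne_atTop 0] with n hn
  have hcard : Nat.card {g : FreeGroup (Fin m) // g ∈ H ∧ wlen g ≤ n} ≤ (2 * m + 1) ^ n :=
    (Set.ncard_le_ncard (fun g (hg : g ∈ {g | g ∈ H ∧ wlen g ≤ n}) => hg.2)
      (finite_wlen_le m n)).trans (card_wlen_le_le m n)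
  refine (Real.rpow_le_rpow (by positivity) (Nat.cast_le.2 hcard) (by positivity)).trans ?_
  rw [Nat.cast_pow, Real.pow_rpow_inv_natCast (by positivity) hn]

/-- **Lower bound on the cogrowth.** If `|S_X^n| / (2m(2m-1)^{n-1}) → 0`, then the growth
rate of `H` in `F` is at least `√(2m-1)`. -/
theorem cogrowth_ge_sqrt_of_sphere_ratio_tendsto_zero (m : ℕ) (hm : 2 ≤ m)
    (H : Subgroup (FreeGroup (Fin m)))
    (hlim : Tendsto (fun n : ℕ =>
        (Nat.card {x : Quotient (QuotientGroup.rightRel H) // normX H x = n} : ℝ) /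
          ((2 * m * (2 * m - 1) ^ (n - 1) : ℕ) : ℝ)) atTop (𝓝 0)) :
    Real.sqrt ((2 * m - 1 : ℕ) : ℝ) ≤
      Filter.limsup (fun n : ℕ =>
        (Nat.card {g : FreeGroup (Fin m) // g ∈ H ∧ wlen g ≤ n} : ℝ) ^ ((n : ℝ)⁻¹)) atTop := by
  by_contra! hlt
  have : NeZero m := ⟨by omega⟩
  obtain ⟨r, hr1, hr2⟩ := exists_between (max_lt hlt (Real.sqrt_pos.2
    (show (0 : ℝ) < ((2 * m - 1 : ℕ) : ℝ) by exact_mod_cast (by omega : 0 < 2 * m - 1))))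
  obtain ⟨hr1, hr0⟩ := max_lt_iff.1 hr1
  obtain ⟨C, hC, hh⟩ := exists_le_mul_pow (fun n => Nat.cast_nonneg _) hr0
    (eventually_lt_of_limsup_lt hr1 (isBoundedUnder_cogrowth H))
  have hq2 : (2 : ℝ) ≤ ((2 * m - 1 : ℕ) : ℝ) := by exact_mod_cast (by omega : 2 ≤ 2 * m - 1)
  have hm0 : (0 : ℝ) < m := by exact_mod_cast (by omega : 0 < m)
  have key := pow_sq_le_sum_mul_sum H
  generalize hq : 2 * m - 1 = q at *
  have hrq : r ^ 2 < q := (Real.lt_sqrt hr0.le).1 hr2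
  have hq0 : (0 : ℝ) < q := by linarith
  have hK : 0 < (1 - r ^ 2 / q)⁻¹ := inv_pos.2 (sub_pos.2 ((div_lt_one hq0).2 hrq))
  refine not_forall_pow_le_mul_sum hq2 (s := fun n =>
    (Nat.card {x : Quotient (QuotientGroup.rightRel H) // normX H x = n} : ℝ)) ?_
    (C := C * (2 * m) * (1 - r ^ 2 / q)⁻¹) (by positivity) fun n => ?_
  · intro ε hε
    filter_upwards [hlim.eventually_le_const (show (0 : ℝ) < ε / (2 * m) by positivity)] with n hn
    have hd : (0 : ℝ) < ((2 * m * q ^ (n - 1) : ℕ) : ℝ) := by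
      push_cast
      positivity
    rw [div_le_iff₀ hd] at hn
    refine hn.trans ?_
    push_cast
    have : (q : ℝ) ^ (n - 1) ≤ q ^ n := pow_le_pow_right₀ (by linarith) (Nat.sub_le _ _)
    calc ε / (2 * m) * (2 * m * (q : ℝ) ^ (n - 1)) = ε * (q : ℝ) ^ (n - 1) := by field_simp
      _ ≤ ε * q ^ n := by gcongr
  · have hpairs : ∑ k ∈ Finset.range (n + 1),
        (Nat.card {g : FreeGroup (Fin m) // g ∈ H ∧ wlen g ≤ 2 * k} : ℝ) *
          (2 * m * (q : ℝ) ^ (n - k)) ≤ C * (2 * m) * (q ^ n * (1 - r ^ 2 / q)⁻¹) := by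
      refine le_trans ?_ (mul_le_mul_of_nonneg_left
        (sum_pow_mul_pow_le (sq_nonneg r) hrq n) (by positivity))
      rw [Finset.mul_sum]
      refine Finset.sum_le_sum fun k _ => ?_
      refine (mul_le_mul_of_nonneg_right (hh (2 * k)) (by positivity)).trans (le_of_eq ?_)
      rw [pow_mul]
      ring
    have hkey := (Nat.cast_le (α := ℝ)).2 (key n)
    push_cast at hkey
    have hS : (0 : ℝ) ≤ ∑ k ∈ Finset.range (n + 1),
        (Nat.card {x : Quotient (QuotientGroup.rightRel H) // normX H x = k} : ℝ) := by positivity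
    have hfin := hkey.trans (mul_le_mul_of_nonneg_left hpairs hS)
    refine le_of_mul_le_mul_left ?_ (pow_pos hq0 n)
    calc (q : ℝ) ^ n * q ^ n = (q ^ n) ^ 2 := by ring
      _ ≤ _ := hfin
      _ = _ := by ring
end
end

section
/- Let H ≤ F be a subgroup. Define the limit set Λ = { ω ∈ ∂F : sup_{h∈H} (h|ω) = ∞ } and the radial limit set Λ^rad = { ω ∈ ∂F : there exists C ∈ ℕ such that the set { h ∈ H : |h| − (h|ω) ≤ C } is infinite }. Then Λ^rad ⊆ Λ, and Λ^rad = Λ if and only if H is finitely generated. -/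
open MeasureTheory Filter Topology
open scoped ENNReal symmDiff

noncomputable section

/-- **König's lemma** for words over a finite alphabet: an infinite set of finite words that is
closed under removing the last letter contains all finite initial segments of an infinite word. -/
theorem exists_infinite_word_of_infinite {α : Type*} [Finite α] (L : Set (List α))
    (hL : ∀ l x, l ++ [x] ∈ L → l ∈ L) (hinf : L.Infinite) :
    ∃ ω : ℕ → α, ∀ n, (List.range n).map ω ∈ L := by
  have hpre : ∀ r l, l ++ r ∈ L → l ∈ L := by
    intro r
    induction r using List.reverseRecOn with
    | nil => simp
    | append_singleton r x ih =>
      intro l h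
      exact ih l (hL _ x (by simpa using h))
  let T : Type _ := {l : List α // {l' ∈ L | l <+: l'}.Infinite}
  have hstep : ∀ t : T, ∃ x, {l' ∈ L | t.1 ++ [x] <+: l'}.Infinite := by
    rintro ⟨l, hl⟩
    by_contra! hcon
    refine hl (((Set.finite_singleton l).union (Set.finite_iUnion hcon)).subset ?_)
    rintro l' ⟨hl', r, rfl⟩
    cases r with
    | nil => simp
    | cons x r =>
      refine Or.inr (Set.mem_iUnion.2 ⟨x, hl', r, by simp⟩)
  choose f hf using hstep
  let t : ℕ → T := fun n =>
    Nat.rec ⟨[], by simpa using hinf⟩ (fun _ s => ⟨s.1 ++ [f s], hf s⟩) n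
  have ht : ∀ n, (List.range n).map (fun k => f (t k)) = (t n).1 := by
    intro n
    induction n with
    | zero => rfl
    | succ n ih => rw [List.range_succ, List.map_append, ih]; rfl
  refine ⟨fun k => f (t k), fun n => ?_⟩
  rw [ht]
  obtain ⟨l', hl', r, rfl⟩ := (t n).2.nonempty
  exact hpre r _ hl'

theorem finite_setOf_wlen_le (m N : ℕ) : {g : FreeGroup (Fin m) | wlen g ≤ N}.Finite :=
  Set.Finite.preimage (f := FreeGroup.toWord) FreeGroup.toWord_injective.injOn
    (List.finite_length_le (Letter m) N)

theorem wlen_mk_le {m : ℕ} (l : List (Letter m)) : wlen (FreeGroup.mk l) ≤ l.length :=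
  FreeGroup.norm_mk_le

theorem toWord_mk_of_isReduced {m : ℕ} {l : List (Letter m)} (h : FreeGroup.IsReduced l) :
    (FreeGroup.mk l).toWord = l := by
  rw [FreeGroup.toWord_mk, h.reduce_eq]

theorem mk_mul_mk_of_toWord_eq_append {m : ℕ} {g : FreeGroup (Fin m)} {p r : List (Letter m)}
    (h : p ++ r = g.toWord) : FreeGroup.mk p * FreeGroup.mk r = g := by
  rw [FreeGroup.mul_mk, h, FreeGroup.mk_toWord]

/-- If the concatenation of two reduced words is not reduced, then the last letter of the first
cancels the first letter of the second. -/
theorem exists_cancel_of_not_isReduced_append {m : ℕ} {l r : List (Letter m)}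
    (hl : FreeGroup.IsReduced l) (hr : FreeGroup.IsReduced r)
    (h : ¬ FreeGroup.IsReduced (l ++ r)) :
    ∃ l' r' x, l = l' ++ [x] ∧ r = linv x :: r' := by
  unfold FreeGroup.IsReduced at *
  rw [List.isChain_append] at h
  push Not at h
  obtain ⟨x, hx, y, hy, h1, h2⟩ := h hl hr
  obtain ⟨l', rfl⟩ := List.getLast?_eq_some_iff.1 hx
  obtain ⟨r', rfl⟩ := List.head?_eq_some_iff.1 hy
  refine ⟨l', r', x, rfl, ?_⟩
  congr 1
  refine Prod.ext h1.symm ?_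
  simp only [linv]
  revert h2
  cases x.2 <;> cases y.2 <;> simp

/-- The reduced word of `g` and the reduced word of `g * w` agree except for their last letters:
an initial segment of the latter is one of the former or nearly exhausts `g * w`. -/
theorem prefix_toWord_or_length_le {m : ℕ} (g : FreeGroup (Fin m)) (w p : List (Letter m))
    (hp : p <+: (g * FreeGroup.mk w).toWord) :
    p <+: g.toWord ∨ wlen (g * FreeGroup.mk w) ≤ p.length + w.length := by
  induction w using List.reverseRecOn generalizing p with
  | nil => left; simpa [← FreeGroup.one_eq_mk] using hp
  | append_singleton w x ih =>
    rw [← FreeGroup.mul_mk, ← mul_assoc] at hp ⊢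
    set k := g * FreeGroup.mk w with hk
    have hk1 : wlen (k * FreeGroup.mk [x]) ≤ wlen k + 1 :=
      (wlen_mul_le _ _).trans (Nat.add_le_add_left (wlen_mk_le _) _)
    have key : p <+: k.toWord ∨ wlen (k * FreeGroup.mk [x]) ≤ p.length := by
      by_cases hred : FreeGroup.IsReduced (k.toWord ++ [x])
      · have hw : (k * FreeGroup.mk [x]).toWord = k.toWord ++ [x] := by
          rw [← toWord_mk_of_isReduced hred, ← FreeGroup.mul_mk, FreeGroup.mk_toWord]
        rw [hw, List.prefix_concat_iff] at hp
        rcases hp with rfl | hp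
        · right; rw [wlen, hw]
        · exact Or.inl hp
      · obtain ⟨l, r, y, hl, hr⟩ := exists_cancel_of_not_isReduced_append
          FreeGroup.isReduced_toWord FreeGroup.IsReduced.singleton hred
        obtain ⟨rfl, rfl⟩ : x = linv y ∧ r = [] := by simpa using hr
        have hlr : FreeGroup.IsReduced l := by
          have := FreeGroup.isReduced_toWord (x := k)
          rw [hl] at this
          exact this.infix (List.prefix_append _ _).isInfix
        have hw : k * FreeGroup.mk [linv y] = FreeGroup.mk l := by
          rw [← FreeGroup.mk_toWord (x := k), hl, FreeGroup.mul_mk, List.append_assoc]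
          have : FreeGroup.Red.Step (l ++ (y.1, y.2) :: (y.1, !y.2) :: []) (l ++ []) :=
            FreeGroup.Red.Step.not
          simpa [linv] using FreeGroup.reduce.exact (FreeGroup.reduce.Step.eq this)
        rw [hw, toWord_mk_of_isReduced hlr] at hp
        left
        rw [hl]
        exact hp.trans (List.prefix_append _ _)
    rcases key with h | h
    · rcases ih p h with h' | h'
      · exact Or.inl h'
      · right; simp only [List.length_append, List.length_singleton]; omega
    · right; omega

/-- Finitely generated subgroups are quasiconvex. -/
theorem exists_wlen_le_mk_mul_mem_closure {m : ℕ} {S : Set (FreeGroup (Fin m))} {C : ℕ}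
    (hS : ∀ s ∈ S, wlen s ≤ C) {h : FreeGroup (Fin m)} (hh : h ∈ Subgroup.closure S)
    {p : List (Letter m)} (hp : p <+: h.toWord) :
    ∃ u, wlen u ≤ C ∧ FreeGroup.mk p * u ∈ Subgroup.closure S := by
  have step : ∀ g s : FreeGroup (Fin m), wlen s ≤ C → g * s ∈ Subgroup.closure S →
      (∀ p, p <+: g.toWord → ∃ u, wlen u ≤ C ∧ FreeGroup.mk p * u ∈ Subgroup.closure S) →
      ∀ p, p <+: (g * s).toWord →
        ∃ u, wlen u ≤ C ∧ FreeGroup.mk p * u ∈ Subgroup.closure S := by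
    intro g s hs hgs ih p hp
    rcases prefix_toWord_or_length_le g s.toWord p (by rwa [FreeGroup.mk_toWord]) with h' | h'
    · exact ih p h'
    · obtain ⟨r, hr⟩ := hp
      refine ⟨FreeGroup.mk r, (wlen_mk_le r).trans ?_, ?_⟩
      · have := congrArg List.length hr
        rw [FreeGroup.mk_toWord] at h'
        simp only [List.length_append] at this
        unfold wlen at *
        omega
      · rwa [mk_mul_mk_of_toWord_eq_append hr]
  induction hh using Subgroup.closure_induction_right generalizing p with
  | one =>
    obtain rfl : p = [] := by simpa using hp
    exact ⟨1, by simp [wlen], by simp [← FreeGroup.one_eq_mk]⟩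
  | mul_right x hx y hy ih =>
    exact step x y (hS y hy) (mul_mem hx (Subgroup.subset_closure hy)) (fun p hp => ih hp) p hp
  | mul_inv_cancel x hx y hy ih =>
    exact step x y⁻¹ ((wlen_inv y).trans_le (hS y hy))
      (mul_mem hx (inv_mem (Subgroup.subset_closure hy))) (fun p hp => ih hp) p hp

/-- The initial segments of reduced words of elements of `H` which are of minimal length in their
right coset of `H`: the vertices of a geodesic spanning tree of the Stallings core graph. -/
def geodesicPrefixes {m : ℕ} (H : Subgroup (FreeGroup (Fin m))) : Set (List (Letter m)) :=
  {p | (∃ h ∈ H, p <+: h.toWord) ∧ ∀ h ∈ H, p.length ≤ wlen (h * FreeGroup.mk p)}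

theorem mem_geodesicPrefixes_of_append_singleton {m : ℕ} {H : Subgroup (FreeGroup (Fin m))}
    (p : List (Letter m)) (x : Letter m) (h : p ++ [x] ∈ geodesicPrefixes H) :
    p ∈ geodesicPrefixes H := by
  obtain ⟨⟨g, hg, hpg⟩, hmin⟩ := h
  refine ⟨⟨g, hg, (List.prefix_append _ _).trans hpg⟩, fun k hk => ?_⟩
  have h1 := hmin k hk
  rw [← FreeGroup.mul_mk, ← mul_assoc, List.length_append] at h1
  have h2 := wlen_mul_le (k * FreeGroup.mk p) (FreeGroup.mk [x])
  have h3 := wlen_mk_le [x]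
  simp only [List.length_singleton] at h1 h3
  omega

/-- Every initial segment of the reduced word of an element of `H` is congruent modulo `H`
to a geodesic one. -/
theorem exists_toWord_mul_mk_mem_geodesicPrefixes {m : ℕ} {H : Subgroup (FreeGroup (Fin m))}
    {h : FreeGroup (Fin m)} (hh : h ∈ H) {p : List (Letter m)} (hp : p <+: h.toWord) :
    ∃ k ∈ H, (k * FreeGroup.mk p).toWord ∈ geodesicPrefixes H := by
  obtain ⟨q, ⟨k, hk, rfl⟩, hmin⟩ := (measure wlen).wf.has_min
    {q : FreeGroup (Fin m) | ∃ k ∈ H, k * FreeGroup.mk p = q} ⟨_, 1, one_mem H, rfl⟩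
  refine ⟨k, hk, ?_, fun g hg => ?_⟩
  · obtain ⟨r, hr⟩ := hp
    set q := k * FreeGroup.mk p with hq
    have hpr : FreeGroup.IsReduced (p ++ r) := hr ▸ FreeGroup.isReduced_toWord
    have hpred := hpr.infix (List.prefix_append p r).isInfix
    have hrred := hpr.infix (List.suffix_append p r).isInfix
    have hpinv : FreeGroup.IsReduced (FreeGroup.invRev p) := by
      rw [← toWord_mk_of_isReduced hpred, ← FreeGroup.toWord_inv]
      exact FreeGroup.isReduced_toWord
    by_cases h1 : FreeGroup.IsReduced (q.toWord ++ r)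
    · refine ⟨q * FreeGroup.mk r, ?_, ?_⟩
      · rw [hq, mul_assoc, mk_mul_mk_of_toWord_eq_append hr]
        exact mul_mem hk hh
      · refine ⟨r, ?_⟩
        rw [← toWord_mk_of_isReduced h1, ← FreeGroup.mul_mk, FreeGroup.mk_toWord]
    by_cases h2 : FreeGroup.IsReduced (q.toWord ++ FreeGroup.invRev p)
    · refine ⟨k, hk, FreeGroup.invRev p, ?_⟩
      rw [← toWord_mk_of_isReduced h2, ← FreeGroup.mul_mk, FreeGroup.mk_toWord,
        ← FreeGroup.inv_mk, hq, mul_inv_cancel_right]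
    · exfalso
      obtain ⟨l₁, r₁, x, e₁, e₂⟩ :=
        exists_cancel_of_not_isReduced_append FreeGroup.isReduced_toWord hrred h1
      obtain ⟨l₂, r₂, y, e₃, e₄⟩ :=
        exists_cancel_of_not_isReduced_append FreeGroup.isReduced_toWord hpinv h2
      obtain ⟨-, rfl⟩ : l₁ = l₂ ∧ x = y := by simpa using e₁.symm.trans e₃
      have e₅ : p = FreeGroup.invRev r₂ ++ [x] := by
        rw [← FreeGroup.invRev_invRev (L₁ := p), e₄]
        simp [FreeGroup.invRev, linv]
      rw [e₅, e₂] at hpr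
      unfold FreeGroup.IsReduced at hpr
      have := (List.isChain_append.1 hpr).2.2 x (by simp) (linv x) (by simp) rfl
      simp [linv] at this
  · rw [FreeGroup.mk_toWord]
    exact not_lt.1 (hmin (g * (k * FreeGroup.mk p)) ⟨g * k, mul_mem hg hk, mul_assoc _ _ _⟩)

theorem fg_of_finite_geodesicPrefixes {m : ℕ} {H : Subgroup (FreeGroup (Fin m))}
    (hfin : (geodesicPrefixes H).Finite) : H.FG := by
  obtain ⟨N, hN⟩ := (hfin.image List.length).bddAbove
  have hN' : ∀ p ∈ geodesicPrefixes H, p.length ≤ N := fun p hp => hN ⟨p, hp, rfl⟩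
  set S : Set (FreeGroup (Fin m)) := {g | g ∈ H ∧ wlen g ≤ 2 * N + 1} with hS
  have hSfin : S.Finite := (finite_setOf_wlen_le m (2 * N + 1)).subset fun g hg => hg.2
  have hSH : Subgroup.closure S ≤ H := (Subgroup.closure_le H).2 fun g hg => hg.1
  refine (Subgroup.fg_iff H).2 ⟨S, le_antisymm hSH fun h hh => ?_, hSfin⟩
  have key : ∀ p : List (Letter m), p <+: h.toWord →
      ∃ q, wlen q ≤ N ∧ FreeGroup.mk p * q⁻¹ ∈ Subgroup.closure S := by
    intro p
    induction p using List.reverseRecOn with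
    | nil => exact fun _ => ⟨1, by simp [wlen], by simp [← FreeGroup.one_eq_mk]⟩
    | append_singleton p x ih =>
      intro hp
      obtain ⟨q, hq, hpq⟩ := ih ((List.prefix_append _ _).trans hp)
      obtain ⟨k, hk, hkp⟩ := exists_toWord_mul_mk_mem_geodesicPrefixes hh hp
      set q' := k * FreeGroup.mk (p ++ [x]) with hq'
      have hq'N : wlen q' ≤ N := hN' _ hkp
      refine ⟨q', hq'N, ?_⟩
      have hs : q * FreeGroup.mk [x] * q'⁻¹ ∈ S := by
        constructor
        · have : q * FreeGroup.mk [x] * q'⁻¹ = (FreeGroup.mk p * q⁻¹)⁻¹ * k⁻¹ := by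
            rw [hq', ← FreeGroup.mul_mk]; group
          rw [this]
          exact mul_mem (inv_mem (hSH hpq)) (inv_mem hk)
        · have h1 := wlen_mul_le (q * FreeGroup.mk [x]) q'⁻¹
          have h2 := wlen_mul_le q (FreeGroup.mk [x])
          have h3 := wlen_mk_le [x]
          rw [wlen_inv] at h1
          simp only [List.length_singleton] at h3
          omega
      have : FreeGroup.mk (p ++ [x]) * q'⁻¹ =
          FreeGroup.mk p * q⁻¹ * (q * FreeGroup.mk [x] * q'⁻¹) := by
        rw [← FreeGroup.mul_mk]; group
      rw [this]
      exact mul_mem hpq (Subgroup.subset_closure hs)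
  obtain ⟨q, hq, hhq⟩ := key h.toWord List.prefix_rfl
  rw [FreeGroup.mk_toWord] at hhq
  have hqH : q ∈ H := by
    have := mul_mem (inv_mem (hSH hhq)) hh
    simpa using this
  have : h = h * q⁻¹ * q := by group
  rw [this]
  exact mul_mem hhq (Subgroup.subset_closure ⟨hqH, by omega⟩)

theorem le_gromov_iff {m : ℕ} {g : FreeGroup (Fin m)} {ω : Boundary m} {n : ℕ} :
    n ≤ gromov g ω ↔ (List.range n).map ω.1 <+: g.toWord := by
  set T : Set ℕ := {k | ∀ i < k, g.toWord[i]? = some (ω.1 i)} with hT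
  have hbdd : BddAbove T := by
    refine ⟨g.toWord.length, fun k hk => ?_⟩
    by_contra! hlt
    simpa using hk _ hlt
  have hmem : gromov g ω ∈ T := Nat.sSup_mem ⟨0, by simp [hT]⟩ hbdd
  have hiff : (List.range n).map ω.1 <+: g.toWord ↔ n ∈ T := by
    rw [List.prefix_iff_getElem?]
    simp [hT]
  rw [hiff]
  exact ⟨fun h i hi => hmem i (hi.trans_le h), fun h => le_csSup hbdd h⟩

theorem gromov_le_wlen {m : ℕ} (g : FreeGroup (Fin m)) (ω : Boundary m) :
    gromov g ω ≤ wlen g := by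
  simpa [wlen] using (le_gromov_iff.1 (le_refl (gromov g ω))).length_le

theorem exists_lt_gromov_of_infinite {m : ℕ} {s : Set (FreeGroup (Fin m))} {ω : Boundary m}
    {C : ℕ} (hs : {g | g ∈ s ∧ wlen g - gromov g ω ≤ C}.Infinite) (D : ℕ) :
    ∃ g ∈ s, D < gromov g ω := by
  by_contra! hcon
  refine hs ((finite_setOf_wlen_le m (D + C)).subset ?_)
  rintro g ⟨hg, hgC⟩
  have := hcon g hg
  simp only [Set.mem_ofPred_eq]
  omega

theorem infinite_of_fg {m : ℕ} {H : Subgroup (FreeGroup (Fin m))} (hH : H.FG) {ω : Boundary m}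
    (hω : ∀ D : ℕ, ∃ g ∈ H, D < gromov g ω) :
    ∃ C : ℕ, {g : FreeGroup (Fin m) | g ∈ H ∧ wlen g - gromov g ω ≤ C}.Infinite := by
  obtain ⟨S, rfl, hSfin⟩ := (Subgroup.fg_iff H).1 hH
  obtain ⟨C, hC⟩ := (hSfin.image wlen).bddAbove
  refine ⟨2 * C + 1, fun hfin => ?_⟩
  obtain ⟨B, hB⟩ := (hfin.image wlen).bddAbove
  obtain ⟨g, hg, hgn⟩ := hω (B + C + 2)
  obtain ⟨u, hu, hmem⟩ := exists_wlen_le_mk_mul_mem_closure (fun s hs => hC ⟨s, hs, rfl⟩) hg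
    (le_gromov_iff.1 hgn.le)
  set p := (List.range (B + C + 2)).map ω.1 with hp
  have hpred : FreeGroup.IsReduced p :=
    FreeGroup.isReduced_toWord.infix (le_gromov_iff.1 hgn.le).isInfix
  set h := FreeGroup.mk p * u with hh
  have hplen : wlen (FreeGroup.mk p) = B + C + 2 := by
    rw [wlen, toWord_mk_of_isReduced hpred]; simp [hp]
  have h1 : wlen h ≤ B + C + 2 + C := by
    have : wlen h ≤ _ := wlen_mul_le (FreeGroup.mk p) u
    omega
  have h2 : B + 1 ≤ gromov h ω := by
    have hpre : (List.range (B + 1)).map ω.1 <+: (h * FreeGroup.mk u⁻¹.toWord).toWord := by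
      rw [FreeGroup.mk_toWord, hh, mul_inv_cancel_right, toWord_mk_of_isReduced hpred, hp,
        show B + C + 2 = B + 1 + (C + 1) by omega, List.range_add (n := B + 1), List.map_append]
      exact List.prefix_append _ _
    rcases prefix_toWord_or_length_le h _ _ hpre with h' | h'
    · exact le_gromov_iff.2 h'
    · rw [FreeGroup.mk_toWord, hh, mul_inv_cancel_right, hplen, List.length_map,
        List.length_range] at h'
      have : u⁻¹.toWord.length = wlen u := wlen_inv u
      omega
  have h3 := gromov_le_wlen h ω
  have := hB ⟨h, ⟨hmem, by omega⟩, rfl⟩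
  omega

theorem exists_boundary_of_not_fg {m : ℕ} {H : Subgroup (FreeGroup (Fin m))} (hH : ¬ H.FG) :
    ∃ ω : Boundary m, (∀ D : ℕ, ∃ g ∈ H, D < gromov g ω) ∧
      ∀ C : ℕ, {g : FreeGroup (Fin m) | g ∈ H ∧ wlen g - gromov g ω ≤ C}.Finite := by
  obtain ⟨ω, hω⟩ := exists_infinite_word_of_infinite (geodesicPrefixes H)
    mem_geodesicPrefixes_of_append_singleton fun hfin => hH (fg_of_finite_geodesicPrefixes hfin)
  have hred : IsRedSeq ω := by
    intro n hn
    obtain ⟨⟨g, -, hg⟩, -⟩ := hω (n + 2)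
    have := FreeGroup.isReduced_toWord.infix hg.isInfix
    rw [List.range_succ, List.range_succ] at this
    simp only [List.map_append, List.map_cons, List.map_nil, List.append_assoc] at this
    have h2 := this.infix (List.suffix_append _ _).isInfix
    simp [FreeGroup.IsReduced, hn, linv] at h2
  refine ⟨⟨ω, hred⟩, fun D => ?_, fun C => ?_⟩
  · obtain ⟨⟨g, hg, hp⟩, -⟩ := hω (D + 1)
    exact ⟨g, hg, le_gromov_iff.2 hp⟩
  · refine (finite_setOf_wlen_le m (2 * C)).subset ?_
    rintro g ⟨hg, hgC⟩
    set n := gromov g ⟨ω, hred⟩ with hn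
    obtain ⟨r, hr⟩ := le_gromov_iff.1 hn.le
    have hlen : n + r.length = wlen g := by
      simpa [wlen] using congrArg List.length hr
    have h1 := (hω n).2 g⁻¹ (inv_mem hg)
    have h2 : g⁻¹ * FreeGroup.mk ((List.range n).map ω) = (FreeGroup.mk r)⁻¹ := by
      rw [← mk_mul_mk_of_toWord_eq_append hr]; group
    rw [h2, wlen_inv, List.length_map, List.length_range] at h1
    have h3 := wlen_mk_le r
    simp only [Set.mem_ofPred_eq]
    omega

/-- **Radial limit set versus full limit set.** `Λ^rad ⊆ Λ`, with equality iff `H` is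
finitely generated. -/
theorem radial_limit_set_eq_limit_set_iff_fg (m : ℕ) (hm : 2 ≤ m)
    (H : Subgroup (FreeGroup (Fin m)))
    (Λ Λrad : Set (Boundary m))
    (hΛ : Λ = {ω : Boundary m | ∀ C : ℕ, ∃ g ∈ H, C < gromov g ω})
    (hΛrad : Λrad = {ω : Boundary m | ∃ C : ℕ,
      {g : FreeGroup (Fin m) | g ∈ H ∧ wlen g - gromov g ω ≤ C}.Infinite}) :
    Λrad ⊆ Λ ∧ (Λrad = Λ ↔ H.FG) := by
  subst hΛ hΛrad
  have hsub : {ω : Boundary m | ∃ C : ℕ,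
      {g : FreeGroup (Fin m) | g ∈ H ∧ wlen g - gromov g ω ≤ C}.Infinite} ⊆
      {ω : Boundary m | ∀ C : ℕ, ∃ g ∈ H, C < gromov g ω} :=
    fun ω ⟨_, hC⟩ => exists_lt_gromov_of_infinite (s := (H : Set (FreeGroup (Fin m)))) hC
  refine ⟨hsub, fun heq => ?_, fun hfg => hsub.antisymm fun ω hω => infinite_of_fg hfg hω⟩
  by_contra hH
  obtain ⟨ω, hω, hfin⟩ := exists_boundary_of_not_fg hH
  obtain ⟨C, hC⟩ := heq.ge hω
  exact hC (hfin C)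
end
end
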